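/- arXiv:2604.00054 — 5 statements merged into one kernel-verified Lean document; each statement's English description precedes it below -/
import Mathlib

section
/- Let b be a prime, m = b², and let χ be a primitive odd Dirichlet character modulo m. Then |Ŝ°(χ)| = (b/(π·φ(m)))·|L(1,χ)|·|S_G(χ)|, where L(1,χ) is the value of the Dirichlet L-function of χ at s = 1. -/
open Finset
open scoped Classical

namespace Collision

/-- The diagonal set `G = {n < b² : ⌊n/b⌋ = n mod b}`. -/
def diagSet (b : ℕ) : Finset ℕ :=
  (Finset.range (b ^ 2)).filter (fun n => n / b = n % b)

/-- The slice increment `d_n(a) = ⌊(n+1)a/b²⌋ − ⌊na/b²⌋`. -/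
def d (b n a : ℕ) : ℤ :=
  ((((n + 1) * a) / b ^ 2 : ℕ) : ℤ) - (((n * a) / b ^ 2 : ℕ) : ℤ)

/-- The collision invariant `S(a) = −1 − ⌊a/b⌋ + Σ_{n∈G} d_n(a)`. -/
def S (b a : ℕ) : ℤ :=
  -1 - ((a / b : ℕ) : ℤ) + ∑ n ∈ diagSet b, d b n a

/-- The units `a' ∈ {0,…,b²−1}` with `a' ≡ a (mod b)`. -/
def cosetUnits (b a : ℕ) : Finset ℕ :=
  (Finset.range (b ^ 2)).filter (fun a' => Nat.gcd a' (b ^ 2) = 1 ∧ a' % b = a % b)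

/-- The centered collision invariant `S°(a)`. -/
noncomputable def Scirc (b a : ℕ) : ℝ :=
  (S b a : ℝ) - (1 / (b : ℝ)) * ∑ a' ∈ cosetUnits b a, (S b a' : ℝ)

/-- The Fourier coefficient `Ŝ°(χ) = (1/φ(b²))·Σ_a S°(a)·χ̄(a)`. -/
noncomputable def Shat (b : ℕ) (χ : DirichletCharacter ℂ (b ^ 2)) : ℂ :=
  (1 / (Nat.totient (b ^ 2) : ℂ)) *
    ∑ a ∈ Finset.range (b ^ 2), (Scirc b a : ℂ) * starRingEnd ℂ (χ (a : ZMod (b ^ 2)))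

/-- The generalized first Bernoulli number `B_{1,χ̄} = (1/b²)·Σ_a a·χ̄(a)`. -/
noncomputable def B1bar (b : ℕ) (χ : DirichletCharacter ℂ (b ^ 2)) : ℂ :=
  (1 / ((b : ℂ) ^ 2)) *
    ∑ a ∈ Finset.range (b ^ 2), (a : ℂ) * starRingEnd ℂ (χ (a : ZMod (b ^ 2)))

/-- The diagonal character sum `S_G(χ) = Σ_{n∈G} [χ̄(n+1) − χ̄(n)]`. -/
noncomputable def SG (b : ℕ) (χ : DirichletCharacter ℂ (b ^ 2)) : ℂ :=
  ∑ n ∈ diagSet b,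
    (starRingEnd ℂ (χ ((n + 1 : ℕ) : ZMod (b ^ 2))) - starRingEnd ℂ (χ (n : ZMod (b ^ 2))))

end Collision

section AbelSum

open Filter Topology MeasureTheory

/-- If a sequence has bounded partial sums, then the right limit at `1` of its Dirichlet series is
the sum of the (conditionally convergent) series `∑ c k / k`. -/
theorem tendsto_sum_inv_mul_of_tendsto_LSeries {c : ℕ → ℂ} (hc : c 0 = 0) {C : ℝ}
    (hC : ∀ n, ‖∑ k ∈ Icc 0 n, c k‖ ≤ C) (hS : ∀ s : ℝ, 1 < s → LSeriesSummable c s) {l : ℂ}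
    (hl : Tendsto (fun s : ℝ ↦ LSeries c s) (𝓝[>] 1) (𝓝 l)) :
    Tendsto (fun n : ℕ ↦ ∑ k ∈ Icc 0 n, ((k : ℝ) : ℂ)⁻¹ * c k) atTop (𝓝 l) := by
  have hC0 : 0 ≤ C := (norm_nonneg _).trans (hC 0)
  have hIcc (n : ℕ) : ∑ k ∈ Icc 0 n, c k = ∑ k ∈ Icc 1 n, c k := by
    rw [← Finset.add_sum_Ioc_eq_sum_Icc (Nat.zero_le n), hc, zero_add]
    rfl
  have hderiv (t : ℝ) (ht : t ∈ Set.Ici (1 : ℝ)) :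
      HasDerivAt (fun t : ℝ ↦ (t : ℂ)⁻¹) (-((t : ℂ) ^ 2)⁻¹) t := by
    have ht0 : (t : ℂ) ≠ 0 := by
      exact_mod_cast (zero_lt_one.trans_le ht).ne'
    simpa using (hasDerivAt_inv ht0).comp_ofReal
  have hsq : IntegrableOn (fun t : ℝ ↦ C * t ^ (-2 : ℝ)) (Set.Ioi 1) :=
    (integrableOn_Ioi_rpow_of_lt (by norm_num) zero_lt_one).const_mul _
  have hloc : LocallyIntegrableOn (deriv fun t : ℝ ↦ (t : ℂ)⁻¹) (Set.Ici 1) := by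
    have : ContinuousOn (fun t : ℝ ↦ -((t : ℂ) ^ 2)⁻¹) (Set.Ici 1) := by
      intro t ht
      have ht0 : (t : ℂ) ≠ 0 := by
        exact_mod_cast (zero_lt_one.trans_le ht).ne'
      exact ContinuousAt.continuousWithinAt (by fun_prop (disch := simpa using ht0))
    refine (this.congr fun t ht ↦ (hderiv t ht).deriv).locallyIntegrableOn measurableSet_Ici
  have hbound (t : ℝ) (ht : 1 ≤ t) :
      ‖deriv (fun t : ℝ ↦ (t : ℂ)⁻¹) t * ∑ k ∈ Icc 0 ⌊t⌋₊, c k‖ ≤ C * t ^ (-2 : ℝ) := by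
    have ht0 : 0 < t := zero_lt_one.trans_le ht
    rw [(hderiv t ht).deriv, norm_mul, mul_comm, Real.rpow_neg ht0.le, Real.rpow_two]
    simp only [norm_neg, norm_inv, norm_pow, Complex.norm_real, Real.norm_eq_abs, sq_abs]
    gcongr
    exact hC _
  have hlim : Tendsto (fun n : ℕ ↦ ((n : ℝ) : ℂ)⁻¹ * ∑ k ∈ Icc 0 n, c k) atTop (𝓝 0) := by
    refine squeeze_zero_norm (a := fun n : ℕ ↦ (n : ℝ)⁻¹ * C) (fun n ↦ ?_) ?_
    · rw [norm_mul, norm_inv, Complex.norm_real, Real.norm_natCast]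
      gcongr
      exact hC n
    · simpa using tendsto_inv_atTop_nhds_zero_nat (𝕜 := ℝ).mul_const C
  have key := tendsto_sum_mul_atTop_nhds_one_sub_integral₀ c hc
    (f := fun t : ℝ ↦ (t : ℂ)⁻¹) (fun t ht ↦ (hderiv t ht).differentiableAt) hloc hlim
    (g := fun t : ℝ ↦ C * t ^ (-2 : ℝ)) ?_ ⟨Set.Ioi 1, Ioi_mem_atTop 1, hsq⟩
  · convert key using 2
    refine tendsto_nhds_unique hl ?_
    have hrep : ∀ᶠ s : ℝ in 𝓝[>] 1, LSeries c s =
        (s : ℂ) * ∫ t in Set.Ioi (1 : ℝ), (∑ k ∈ Icc 1 ⌊t⌋₊, c k) * (t : ℂ) ^ (-((s : ℂ) + 1)) := by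
      filter_upwards [self_mem_nhdsWithin] with s hs
      refine LSeries_eq_mul_integral c le_rfl (by simpa using zero_lt_one.trans hs) (hS s hs) ?_
      refine Asymptotics.IsBigO.of_bound C (Eventually.of_forall fun n ↦ ?_)
      simpa [hIcc] using hC n
    refine Tendsto.congr' (hrep.mono fun _ h ↦ h.symm) ?_
    have hint : Tendsto (fun s : ℝ ↦
        ∫ t in Set.Ioi (1 : ℝ), (∑ k ∈ Icc 1 ⌊t⌋₊, c k) * (t : ℂ) ^ (-((s : ℂ) + 1))) (𝓝[>] 1)
        (𝓝 (∫ t in Set.Ioi (1 : ℝ), (∑ k ∈ Icc 1 ⌊t⌋₊, c k) * (t : ℂ) ^ (-(((1 : ℝ) : ℂ) + 1)))) := by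
      refine tendsto_integral_filter_of_dominated_convergence _ ?_ ?_ hsq ?_
      · refine Eventually.of_forall fun s ↦ AEStronglyMeasurable.mul ?_ ?_
        · exact ((measurable_from_nat (f := fun n : ℕ ↦ ∑ k ∈ Icc 1 n, c k)).comp
            Nat.measurable_floor).aestronglyMeasurable
        · exact (by fun_prop : Measurable fun t : ℝ ↦ (t : ℂ) ^ (-((s : ℂ) + 1))).aestronglyMeasurable
      · filter_upwards [self_mem_nhdsWithin] with s hs
        refine (ae_restrict_mem measurableSet_Ioi).mono fun t ht ↦ ?_
        have ht0 : (0 : ℝ) < t := zero_lt_one.trans ht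
        rw [norm_mul, Complex.norm_cpow_eq_rpow_re_of_pos ht0, ← hIcc]
        gcongr
        · exact hC _
        · exact le_of_lt ht
        · simp only [Complex.neg_re, Complex.add_re, Complex.ofReal_re, Complex.one_re]
          have : (1 : ℝ) < s := hs
          linarith
      · refine (ae_restrict_mem measurableSet_Ioi).mono fun t ht ↦ ?_
        have ht0 : (t : ℂ) ≠ 0 := by
          exact_mod_cast (zero_lt_one.trans ht).ne'
        refine Tendsto.mono_left (ContinuousAt.tendsto ?_) nhdsWithin_le_nhds
        refine continuousAt_const.mul (ContinuousAt.const_cpow (by fun_prop) (Or.inl ht0))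
    have hs1 : Tendsto (fun s : ℝ ↦ (s : ℂ)) (𝓝[>] 1) (𝓝 ((1 : ℝ) : ℂ)) :=
      (Complex.continuous_ofReal.tendsto 1).mono_left nhdsWithin_le_nhds
    convert hs1.mul hint using 2
    rw [zero_sub, ← integral_neg, Complex.ofReal_one, one_mul]
    refine setIntegral_congr_fun measurableSet_Ioi fun t ht ↦ ?_
    have : (-((1 : ℂ) + 1)) = ((-2 : ℤ) : ℂ) := by norm_num
    simp only [(hderiv t (Set.Ioi_subset_Ici_self ht)).deriv, hIcc, this, Complex.cpow_intCast]
    rw [neg_mul, neg_neg, mul_comm]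
    rfl
  · refine Asymptotics.IsBigO.of_bound 1 ?_
    filter_upwards [eventually_ge_atTop 1] with t ht
    rw [one_mul]
    exact (hbound t ht).trans (Real.le_norm_self _)

end AbelSum

section ExpZeta

open Filter Topology HurwitzZeta

theorem norm_sum_Icc_ite_pow_le {z : ℂ} (hz : ‖z‖ = 1) (hz1 : z ≠ 1) (n : ℕ) :
    ‖∑ k ∈ Icc 0 n, (if k = 0 then 0 else z ^ k)‖ ≤ 2 / ‖z - 1‖ + 1 := by
  have hsum : ∑ k ∈ Icc 0 n, (if k = 0 then 0 else z ^ k) = (z ^ (n + 1) - 1) / (z - 1) - 1 := by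
    rw [← geom_sum_eq hz1, ← Nat.range_succ_eq_Icc_zero, Finset.sum_range_succ',
      Finset.sum_range_succ']
    simp
  rw [hsum]
  refine (norm_sub_le _ _).trans ?_
  rw [norm_one, norm_div]
  gcongr
  refine (norm_sub_le _ _).trans ?_
  rw [norm_pow, hz]
  norm_num

theorem expZeta_apply_one {a : ℝ} (ha : (a : UnitAddCircle) ≠ 0) :
    expZeta a 1 = -Complex.log (1 - Complex.exp (2 * Real.pi * Complex.I * a)) := by
  set z := Complex.exp (2 * Real.pi * Complex.I * a) with hzdef
  have hz : ‖z‖ = 1 := by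
    rw [hzdef, show (2 * Real.pi * Complex.I * a : ℂ) = ((2 * Real.pi * a : ℝ) : ℂ) * Complex.I by
      push_cast; ring, Complex.norm_exp_ofReal_mul_I]
  have hz1 : z ≠ 1 := by
    intro h
    obtain ⟨n, hn⟩ := Complex.exp_eq_one_iff.mp h
    refine ha ((AddCircle.coe_eq_zero_iff 1).mpr ⟨n, ?_⟩)
    have h2 : (2 * Real.pi * Complex.I : ℂ) ≠ 0 := Complex.two_pi_I_ne_zero
    have : (a : ℂ) = n := mul_left_cancel₀ h2 (by rw [hn]; ring)
    simpa using (by exact_mod_cast this.symm : (n : ℝ) = a)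
  let c : ℕ → ℂ := fun k ↦ if k = 0 then 0 else z ^ k
  have hLS (s : ℝ) (hs : 1 < s) : LSeriesHasSum c s (expZeta a s) := by
    refine (LSeriesHasSum_congr s _ fun {n} hn ↦ ?_).mp (LSeriesHasSum_exp a (s := s) (by simpa))
    simp only [c, if_neg hn, hzdef, ← Complex.exp_nat_mul]
    congr 1
    ring
  have hl : Tendsto (fun s : ℝ ↦ LSeries c s) (𝓝[>] 1) (𝓝 (expZeta a 1)) := by
    have hcont : Tendsto (fun s : ℝ ↦ expZeta a s) (𝓝[>] 1) (𝓝 (expZeta a (1 : ℝ))) :=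
      (((differentiable_expZeta_of_ne_zero ha).continuous.comp
        Complex.continuous_ofReal).tendsto 1).mono_left nhdsWithin_le_nhds
    rw [Complex.ofReal_one] at hcont
    refine hcont.congr' ?_
    filter_upwards [self_mem_nhdsWithin] with s hs using (hLS s hs).LSeries_eq.symm
  have hsum := tendsto_sum_inv_mul_of_tendsto_LSeries (c := c) (by simp [c])
    (norm_sum_Icc_ite_pow_le hz hz1) (fun s hs ↦ (hLS s hs).LSeriesSummable) hl
  have hsum' : Tendsto (fun n ↦ ∑ k ∈ range n, ((k : ℝ) : ℂ)⁻¹ * c k) atTop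
      (𝓝 (expZeta a 1)) := by
    rw [← tendsto_add_atTop_iff_nat 1]
    exact hsum.congr fun n ↦ by rw [Nat.range_succ_eq_Icc_zero]
  have habel := Complex.tendsto_tsum_powerSeries_nhdsWithin_lt hsum'
  rw [tendsto_map'_iff] at habel
  refine tendsto_nhds_unique habel ?_
  have hslit : 1 - z ∈ Complex.slitPlane := by
    refine Complex.mem_slitPlane_iff.mpr (Or.inl ?_)
    have hsq : z.re * z.re + z.im * z.im = 1 := by
      rw [← Complex.normSq_apply, Complex.normSq_eq_norm_sq, hz, one_pow]
    rw [Complex.sub_re, Complex.one_re, sub_pos]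
    refine lt_of_le_of_ne (by nlinarith [mul_self_nonneg z.im]) fun h ↦ hz1 (Complex.ext h ?_)
    rw [h, one_mul, add_eq_left] at hsq
    simpa using hsq
  have hlog : Tendsto (fun x : ℝ ↦ -Complex.log (1 - z * x)) (𝓝[<] 1)
      (𝓝 (-Complex.log (1 - z))) := by
    have : ContinuousAt (fun x : ℝ ↦ -Complex.log (1 - z * x)) 1 := by
      refine (ContinuousAt.clog (by fun_prop) (by simpa using hslit)).neg
    simpa using this.tendsto.mono_left nhdsWithin_le_nhds
  refine hlog.congr' ?_
  filter_upwards [Ioo_mem_nhdsLT (show (-1 : ℝ) < 1 by norm_num)] with x hx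
  have hzx : ‖z * x‖ < 1 := by
    rw [norm_mul, hz, one_mul, Complex.norm_real, Real.norm_eq_abs]
    exact abs_lt.mpr hx
  rw [← (Complex.hasSum_taylorSeries_neg_log hzx).tsum_eq]
  refine tsum_congr fun n ↦ ?_
  rcases eq_or_ne n 0 with rfl | hn
  · simp
  · simp only [c, if_neg hn, mul_pow, Complex.ofReal_natCast]
    ring

theorem log_one_sub_exp {x : ℝ} (h0 : 0 < x) (h1 : x < 1) :
    Complex.log (1 - Complex.exp (2 * Real.pi * Complex.I * x)) =
      Real.log (2 * Real.sin (Real.pi * x)) + (Real.pi * (x - 1 / 2) : ℝ) * Complex.I := by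
  have hpi := Real.pi_pos
  have hsin : 0 < 2 * Real.sin (Real.pi * x) :=
    mul_pos two_pos (Real.sin_pos_of_pos_of_lt_pi (by positivity) (by nlinarith))
  have hfac : 1 - Complex.exp (2 * Real.pi * Complex.I * x) =
      ((2 * Real.sin (Real.pi * x) : ℝ) : ℂ) *
        Complex.exp ((Real.pi * (x - 1 / 2) : ℝ) * Complex.I) := by
    have hh : Complex.exp ((Real.pi * (x - 1 / 2) : ℝ) * Complex.I) =
        Complex.exp (Real.pi * x * Complex.I) * (-Complex.I) := by
      rw [← Complex.exp_neg_pi_div_two_mul_I, ← Complex.exp_add]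
      congr 1
      push_cast
      ring
    rw [hh]
    push_cast
    rw [Complex.sin, show (2 * Real.pi * Complex.I * x : ℂ) =
      Real.pi * x * Complex.I + Real.pi * x * Complex.I by ring, Complex.exp_add,
      show (-(Real.pi * x) * Complex.I : ℂ) = -(Real.pi * x * Complex.I) by ring, Complex.exp_neg]
    have := Complex.exp_ne_zero (Real.pi * x * Complex.I)
    field_simp
    linear_combination (1 - Complex.exp (Real.pi * x * Complex.I) ^ 2) * Complex.I_sq
  rw [hfac, Complex.log_ofReal_mul hsin (Complex.exp_ne_zero _), Complex.log_exp]
  · simp only [Complex.mul_im, Complex.ofReal_re, Complex.ofReal_im, Complex.I_re, Complex.I_im]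
    nlinarith
  · simp only [Complex.mul_im, Complex.ofReal_re, Complex.ofReal_im, Complex.I_re, Complex.I_im]
    nlinarith

theorem expZeta_toAddCircle_apply_one {N : ℕ} [NeZero N] {j : ZMod N} (hj : j ≠ 0) :
    expZeta (ZMod.toAddCircle j) 1 = -(Real.log (2 * Real.sin (Real.pi * (j.val / N : ℝ))) +
      (Real.pi * ((j.val / N : ℝ) - 1 / 2) : ℝ) * Complex.I) := by
  have hN : (0 : ℝ) < N := by exact_mod_cast NeZero.pos N
  have hne : ((j.val / N : ℝ) : UnitAddCircle) ≠ 0 := by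
    rwa [← ZMod.toAddCircle_apply, Ne, ZMod.toAddCircle_eq_zero]
  rw [ZMod.toAddCircle_apply, expZeta_apply_one hne, log_one_sub_exp]
  · have : 0 < j.val := Nat.pos_of_ne_zero ((ZMod.val_ne_zero j).mpr hj)
    positivity
  · rw [div_lt_one hN]
    exact_mod_cast j.val_lt

theorem expZeta_toAddCircle_neg_sub {N : ℕ} [NeZero N] {j : ZMod N} (hj : j ≠ 0) :
    expZeta (ZMod.toAddCircle (-j)) 1 - expZeta (ZMod.toAddCircle j) 1 =
      2 * Real.pi * Complex.I * ((j.val : ℂ) / N - 1 / 2) := by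
  have hN : (N : ℝ) ≠ 0 := NeZero.ne _
  have : NeZero j := ⟨hj⟩
  have hval : (((-j).val : ℝ) / N) = 1 - j.val / N := by
    rw [ZMod.val_neg_of_ne_zero, Nat.cast_sub j.val_lt.le]
    field_simp
  rw [expZeta_toAddCircle_apply_one hj, expZeta_toAddCircle_apply_one (neg_ne_zero.mpr hj), hval,
    show Real.pi * (1 - (j.val / N : ℝ)) = Real.pi - Real.pi * (j.val / N) by ring, Real.sin_pi_sub]
  push_cast
  ring

/-- The value at `1` of the `L`-function of the discrete Fourier transform of an odd function. -/
theorem LFunction_dft_one_of_odd {N : ℕ} [NeZero N] {Φ : ZMod N → ℂ} (hΦ : Φ.Odd) :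
    ZMod.LFunction (ZMod.dft Φ) 1 =
      Real.pi * Complex.I * ∑ j : ZMod N, (j.val : ℂ) / N * Φ j := by
  have hΦ0 : Φ 0 = 0 := by
    have := hΦ 0
    rw [neg_zero] at this
    exact self_eq_neg.mp this
  have hneg (F : ZMod N → ℂ) : ∑ j, F (-j) = ∑ j, F j := Equiv.sum_comp (Equiv.neg _) F
  have hsum : ∑ j, Φ j = 0 := by
    have := hneg Φ
    simp only [hΦ _, Finset.sum_neg_distrib] at this
    exact self_eq_neg.mp this.symm
  rw [ZMod.LFunction_dft Φ (Or.inl hΦ0)]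
  have hdbl : 2 * ∑ j, Φ j * expZeta (ZMod.toAddCircle (-j)) 1 =
      ∑ j, Φ j * (expZeta (ZMod.toAddCircle (-j)) 1 - expZeta (ZMod.toAddCircle j) 1) := by
    have := hneg fun j ↦ Φ j * expZeta (ZMod.toAddCircle (-j)) 1
    simp only [hΦ _, neg_neg, neg_mul, Finset.sum_neg_distrib] at this
    rw [two_mul]
    simp only [mul_sub, Finset.sum_sub_distrib]
    linear_combination -this
  have hval : ∑ j, Φ j * (expZeta (ZMod.toAddCircle (-j)) 1 - expZeta (ZMod.toAddCircle j) 1) =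
      ∑ j : ZMod N, (2 * Real.pi * Complex.I * ((j.val : ℂ) / N * Φ j) -
        Real.pi * Complex.I * Φ j) := by
    refine Finset.sum_congr rfl fun j _ ↦ ?_
    rcases eq_or_ne j 0 with rfl | hj
    · simp [hΦ0]
    · rw [expZeta_toAddCircle_neg_sub hj]
      ring
  rw [hval, Finset.sum_sub_distrib, ← Finset.mul_sum, ← Finset.mul_sum, hsum] at hdbl
  linear_combination hdbl / 2

end ExpZeta

section Characters

open DirichletCharacter

variable {N : ℕ} [NeZero N]

theorem exists_unit_of_isPrimitive {χ : DirichletCharacter ℂ N} (hχ : χ.IsPrimitive) {d : ℕ}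
    (hd : d ∣ N) (hdN : d < N) :
    ∃ u : (ZMod N)ˣ, ((u : ZMod N).val : ZMod d) = 1 ∧ χ u ≠ 1 := by
  have hnot : ¬ χ.FactorsThrough d := fun h ↦ by
    have hle : χ.conductor ≤ d := Nat.sInf_le h
    rw [(isPrimitive_def χ).mp hχ] at hle
    exact absurd hle (not_le.mpr hdN)
  rw [factorsThrough_iff_ker_unitsMap hd, SetLike.not_le_iff_exists] at hnot
  obtain ⟨u, hu, hχu⟩ := hnot
  refine ⟨u, ?_, fun h ↦ hχu ?_⟩
  · have := congrArg Units.val (MonoidHom.mem_ker.mp hu)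
    rwa [ZMod.unitsMap_val, Units.val_one, ← ZMod.natCast_val] at this
  · rw [MonoidHom.mem_ker, Units.ext_iff, MulChar.coe_toUnitHom, h, Units.val_one]

theorem sum_mul_eq_zero_of_invariant {χ : DirichletCharacter ℂ N} {u : (ZMod N)ˣ} (hu : χ u ≠ 1)
    {F : ZMod N → ℂ} (hF : ∀ x, F (u * x) = F x) : ∑ x, F x * χ x = 0 := by
  have h : ∑ x, F (u * x) * χ (u * x) = ∑ x, F x * χ x :=
    Equiv.sum_comp u.mulLeft fun x ↦ F x * χ x
  simp only [hF, map_mul] at h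
  have h' : χ u * ∑ x, F x * χ x = ∑ x, F x * χ x := by
    rw [Finset.mul_sum]
    exact (Finset.sum_congr rfl fun x _ ↦ by ring).trans h
  by_contra h0
  exact hu (mul_right_cancel₀ h0 (h'.trans (one_mul _).symm))

theorem mul_unit_eq_self {n : ZMod N} {u : (ZMod N)ˣ}
    (hu : ((u : ZMod N).val : ZMod (N / n.val.gcd N)) = 1) : n * u = n := by
  have hg : n.val.gcd N ∣ N := Nat.gcd_dvd_right _ _
  have hd : N / n.val.gcd N ∣ N := Nat.div_dvd_of_dvd hg
  have h1 : ((((u : ZMod N) - 1).val : ℕ) : ZMod (N / n.val.gcd N)) = 0 := by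
    rw [ZMod.natCast_val] at hu ⊢
    rw [ZMod.cast_sub hd, hu, ZMod.cast_one hd, sub_self]
  rw [ZMod.natCast_eq_zero_iff] at h1
  have h2 : N ∣ n.val * ((u : ZMod N) - 1).val := by
    calc N = n.val.gcd N * (N / n.val.gcd N) := (Nat.mul_div_cancel' hg).symm
      _ ∣ _ := Nat.mul_dvd_mul (Nat.gcd_dvd_left _ _) h1
  have h3 : n * ((u : ZMod N) - 1) = 0 := by
    have := (ZMod.natCast_eq_zero_iff _ _).mpr h2
    rwa [Nat.cast_mul, ZMod.natCast_zmod_val, ZMod.natCast_zmod_val] at this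
  linear_combination h3

theorem sum_comp_mul_left_of_isPrimitive {χ : DirichletCharacter ℂ N} (hχ : χ.IsPrimitive)
    (F : ZMod N → ℂ) (n : ZMod N) : ∑ x, F (n * x) * χ x = χ⁻¹ n * ∑ x, F x * χ x := by
  by_cases hn : IsUnit n
  · obtain ⟨u, rfl⟩ := hn
    rw [← Equiv.sum_comp u.mulLeft fun x ↦ F x * χ x, Finset.mul_sum]
    refine Finset.sum_congr rfl fun x _ ↦ ?_
    have : χ⁻¹ (u : ZMod N) * χ (u : ZMod N) = 1 := by
      rw [← MulChar.mul_apply, inv_mul_cancel, MulChar.one_apply_coe]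
    rw [Units.mulLeft_apply, map_mul]
    linear_combination -(F (u * x) * χ x) * this
  · rw [MulChar.map_nonunit _ hn, zero_mul]
    have hg : 1 < n.val.gcd N := by
      refine lt_of_le_of_ne (Nat.gcd_pos_of_pos_right _ (NeZero.pos N)) fun h ↦ hn ?_
      rw [← ZMod.natCast_zmod_val n, ZMod.isUnit_iff_coprime]
      exact h.symm
    obtain ⟨u, hu, hχu⟩ := exists_unit_of_isPrimitive hχ
      (Nat.div_dvd_of_dvd (Nat.gcd_dvd_right n.val N)) (Nat.div_lt_self (NeZero.pos N) hg)
    exact sum_mul_eq_zero_of_invariant hχu fun x ↦ by rw [← mul_assoc, mul_unit_eq_self hu]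

theorem sum_range_eq_sum_zmod (f : ℕ → ℂ) : ∑ a ∈ range N, f a = ∑ x : ZMod N, f x.val := by
  refine Finset.sum_nbij' (fun a ↦ (a : ZMod N)) ZMod.val (by simp)
    (fun x _ ↦ by simpa using x.val_lt) (fun a ha ↦ ZMod.val_natCast_of_lt (by simpa using ha))
    (by simp) fun a ha ↦ by rw [ZMod.val_natCast_of_lt (by simpa using ha)]

theorem sum_floor_mul_of_isPrimitive {χ : DirichletCharacter ℂ N} (hχ : χ.IsPrimitive) (n : ℕ) :
    ∑ a ∈ range N, ((n * a / N : ℕ) : ℂ) * χ a =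
      (n - χ⁻¹ n) * ∑ x : ZMod N, (x.val : ℂ) / N * χ x := by
  have hN : (N : ℂ) ≠ 0 := NeZero.ne _
  rw [sum_range_eq_sum_zmod, sub_mul,
    ← sum_comp_mul_left_of_isPrimitive hχ (fun x ↦ (x.val : ℂ) / N), Finset.mul_sum,
    ← Finset.sum_sub_distrib]
  refine Finset.sum_congr rfl fun x _ ↦ ?_
  have hval : ((n : ZMod N) * x).val = n * x.val % N := by
    rw [← ZMod.val_natCast, Nat.cast_mul, ZMod.natCast_zmod_val]
  have hdiv : ((N * (n * x.val / N) + n * x.val % N : ℕ) : ℂ) = (n * x.val : ℕ) := by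
    rw [Nat.div_add_mod]
  push_cast at hdiv
  rw [hval, ZMod.natCast_zmod_val]
  field_simp
  linear_combination χ x * hdiv

theorem norm_gaussSum_sq_of_isPrimitive {χ : DirichletCharacter ℂ N} (hχ : χ.IsPrimitive) :
    ‖gaussSum χ ZMod.stdAddChar‖ ^ 2 = N := by
  have hχ' : χ⁻¹.IsPrimitive := by
    rw [isPrimitive_def, conductor_inv]
    exact hχ
  have h1 : ZMod.dft (ZMod.dft χ) 1 = N • χ (-1) := by
    rw [ZMod.dft_dft]
    simp
  have h2 : ZMod.dft χ = fun k ↦ χ⁻¹ (-1) * gaussSum χ ZMod.stdAddChar * χ⁻¹ k := by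
    funext k
    rw [hχ.fourierTransform_eq_inv_mul_gaussSum, ← neg_one_mul, map_mul]
    ring
  rw [h2, ZMod.dft_const_mul] at h1
  simp only [hχ'.fourierTransform_eq_inv_mul_gaussSum, inv_inv] at h1
  have hu (ψ : DirichletCharacter ℂ N) : ‖ψ (-1)‖ = 1 := by
    simpa using ψ.unit_norm_eq_one (-1)
  have hinv : ‖gaussSum χ⁻¹ ZMod.stdAddChar‖ = ‖gaussSum χ ZMod.stdAddChar‖ := by
    have h3 := star_gaussSum_eq χ (ZMod.stdAddChar (N := N))
    have h4 := gaussSum_mulShift_of_isPrimitive (ZMod.stdAddChar (N := N)) hχ' (-1)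
    rw [AddChar.inv_mulShift, h4] at h3
    have := congrArg norm h3
    rwa [norm_star, norm_mul, hu, one_mul, eq_comm] at this
  have h5 := congrArg norm h1
  simp only [norm_mul, hu, one_mul, hinv, nsmul_eq_mul, mul_one, Complex.norm_natCast] at h5
  rw [sq, h5]

/-- For an odd primitive character, `|L(1, χ)|` in terms of the generalized Bernoulli number of
the inverse character. -/
theorem norm_LFunction_one_of_isPrimitive_of_odd {χ : DirichletCharacter ℂ N}
    (hχ : χ.IsPrimitive) (hodd : χ.Odd) :
    √N * ‖χ.LFunction 1‖ = Real.pi * ‖∑ x : ZMod N, (x.val : ℂ) / N * χ⁻¹ x‖ := by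
  have hχ' : χ⁻¹.IsPrimitive := by
    rw [isPrimitive_def, conductor_inv]
    exact hχ
  have hodd' : χ⁻¹.Odd := by
    rw [DirichletCharacter.Odd, MulChar.inv_apply_eq_inv', hodd]
    norm_num
  have hg : ‖gaussSum χ⁻¹ ZMod.stdAddChar‖ = √N := by
    rw [← norm_gaussSum_sq_of_isPrimitive hχ', Real.sqrt_sq (norm_nonneg _)]
  have hdft : ZMod.dft ⇑(χ⁻¹) = fun k ↦ -gaussSum χ⁻¹ ZMod.stdAddChar * χ k := by
    funext k
    rw [hχ'.fourierTransform_eq_inv_mul_gaussSum, inv_inv, ← neg_one_mul, map_mul, hodd]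
    ring
  have hL : ZMod.LFunction (ZMod.dft ⇑(χ⁻¹)) 1 = -gaussSum χ⁻¹ ZMod.stdAddChar * χ.LFunction 1 := by
    rw [hdft, DirichletCharacter.LFunction]
    simp only [ZMod.LFunction, Finset.mul_sum]
    exact Finset.sum_congr rfl fun k _ ↦ by ring
  rw [LFunction_dft_one_of_odd hodd'.to_fun] at hL
  have := congrArg norm hL
  simpa [hg, abs_of_pos Real.pi_pos] using this.symm

end Characters

namespace Collision

theorem mem_diagSet_iff {b n : ℕ} (hb : 0 < b) : n ∈ diagSet b ↔ ∃ q < b, q * (b + 1) = n := by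
  rw [diagSet, Finset.mem_filter, Finset.mem_range]
  constructor
  · rintro ⟨-, hn⟩
    refine ⟨n % b, Nat.mod_lt _ hb, ?_⟩
    conv_rhs => rw [← Nat.div_add_mod n b, hn]
    ring
  · rintro ⟨q, hq, rfl⟩
    have heq : q * (b + 1) = q + b * q := by ring
    refine ⟨by nlinarith, ?_⟩
    rw [heq, Nat.add_mul_div_left _ _ hb, Nat.add_mul_mod_self_left, Nat.div_eq_of_lt hq,
      Nat.mod_eq_of_lt hq, zero_add]

theorem card_diagSet {b : ℕ} (hb : 0 < b) : (diagSet b).card = b := by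
  have : diagSet b = (Finset.range b).image (· * (b + 1)) := by
    ext n
    simp [mem_diagSet_iff hb]
  rw [this, Finset.card_image_of_injective _ (mul_left_injective₀ (Nat.succ_ne_zero b)),
    Finset.card_range]

variable {b : ℕ} [NeZero (b ^ 2)] {χ : DirichletCharacter ℂ (b ^ 2)}

theorem sum_S_mul (hb : b.Prime) (hχ : χ.IsPrimitive) :
    ∑ a ∈ range (b ^ 2), (S b a : ℂ) * χ a =
      -(∑ n ∈ diagSet b, (χ⁻¹ ((n + 1 : ℕ) : ZMod (b ^ 2)) - χ⁻¹ (n : ZMod (b ^ 2)))) *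
        ∑ x : ZMod (b ^ 2), (x.val : ℂ) / (b ^ 2 : ℕ) * χ x := by
  set B := ∑ x : ZMod (b ^ 2), (x.val : ℂ) / (b ^ 2 : ℕ) * χ x
  have hlt : 1 < b ^ 2 := Nat.one_lt_pow two_ne_zero hb.one_lt
  have hone : ∑ a ∈ range (b ^ 2), χ a = 0 := by
    rw [sum_range_eq_sum_zmod]
    obtain ⟨u, -, hu⟩ := exists_unit_of_isPrimitive hχ (one_dvd _) hlt
    simpa using sum_mul_eq_zero_of_invariant hu (F := fun _ ↦ 1) fun _ ↦ rfl
  have hfloor : ∑ a ∈ range (b ^ 2), ((a / b : ℕ) : ℂ) * χ a = b * B := by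
    have h := sum_floor_mul_of_isPrimitive hχ b
    have hdiv (a : ℕ) : b * a / b ^ 2 = a / b := by
      rw [sq, Nat.mul_div_mul_left _ _ hb.pos]
    have hnu : ¬ IsUnit (b : ZMod (b ^ 2)) := by
      rw [ZMod.isUnit_iff_coprime, Nat.coprime_pow_right_iff two_pos, Nat.coprime_self]
      exact hb.one_lt.ne'
    rw [MulChar.map_nonunit _ hnu, sub_zero] at h
    simpa only [hdiv] using h
  have hd (n : ℕ) : ∑ a ∈ range (b ^ 2), (d b n a : ℂ) * χ a =
      B - (χ⁻¹ ((n + 1 : ℕ) : ZMod (b ^ 2)) - χ⁻¹ (n : ZMod (b ^ 2))) * B := by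
    simp only [d, Int.cast_sub, Int.cast_natCast, sub_mul, Finset.sum_sub_distrib]
    rw [sum_floor_mul_of_isPrimitive hχ, sum_floor_mul_of_isPrimitive hχ, Nat.cast_succ (R := ℂ)]
    ring
  have hsplit : ∑ a ∈ range (b ^ 2), (S b a : ℂ) * χ a =
      -∑ a ∈ range (b ^ 2), χ a - ∑ a ∈ range (b ^ 2), ((a / b : ℕ) : ℂ) * χ a +
        ∑ n ∈ diagSet b, ∑ a ∈ range (b ^ 2), (d b n a : ℂ) * χ a := by
    rw [Finset.sum_comm, ← Finset.sum_neg_distrib, ← Finset.sum_sub_distrib,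
      ← Finset.sum_add_distrib]
    refine Finset.sum_congr rfl fun a _ ↦ ?_
    rw [← Finset.sum_mul, S, Int.cast_add, Int.cast_sub, Int.cast_natCast, Int.cast_sum]
    push_cast
    ring
  rw [hsplit, hone, hfloor]
  simp only [hd]
  rw [Finset.sum_sub_distrib, Finset.sum_const, card_diagSet hb.pos, ← Finset.sum_mul, nsmul_eq_mul]
  ring

theorem sum_average_mul (hb : b.Prime) (hχ : χ.IsPrimitive) :
    ∑ a ∈ range (b ^ 2), (∑ a' ∈ cosetUnits b a, (S b a' : ℂ)) * χ a = 0 := by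
  have hdvd : b ∣ b ^ 2 := dvd_pow_self b two_ne_zero
  obtain ⟨u, hu, hχu⟩ := exists_unit_of_isPrimitive hχ hdvd
    (lt_self_pow₀ hb.one_lt one_lt_two)
  have hmod (x : ZMod (b ^ 2)) : ((u : ZMod (b ^ 2)) * x).val % b = x.val % b := by
    rw [ZMod.val_mul, Nat.mod_mod_of_dvd _ hdvd, ← ZMod.natCast_eq_natCast_iff', Nat.cast_mul, hu,
      one_mul]
  rw [sum_range_eq_sum_zmod]
  simp only [ZMod.natCast_zmod_val]
  exact sum_mul_eq_zero_of_invariant hχu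
    (F := fun x ↦ ∑ a' ∈ cosetUnits b x.val, (S b a' : ℂ)) fun x ↦ by simp only [cosetUnits, hmod]

theorem sum_Scirc_mul (hb : b.Prime) (hχ : χ.IsPrimitive) :
    ∑ a ∈ range (b ^ 2), (Scirc b a : ℂ) * χ a = ∑ a ∈ range (b ^ 2), (S b a : ℂ) * χ a := by
  have h : ∑ a ∈ range (b ^ 2), (Scirc b a : ℂ) * χ a = ∑ a ∈ range (b ^ 2), (S b a : ℂ) * χ a -
      1 / b * ∑ a ∈ range (b ^ 2), (∑ a' ∈ cosetUnits b a, (S b a' : ℂ)) * χ a := by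
    rw [Finset.mul_sum, ← Finset.sum_sub_distrib]
    refine Finset.sum_congr rfl fun a _ ↦ ?_
    rw [Scirc]
    push_cast
    ring
  rw [h, sum_average_mul hb hχ, mul_zero, sub_zero]

end Collision

open Collision in
theorem stmt2 (b : ℕ) (hb : b.Prime) (χ : DirichletCharacter ℂ (b ^ 2))
    (hprim : χ.IsPrimitive) (hodd : χ.Odd) :
    haveI : NeZero (b ^ 2) := ⟨pow_ne_zero 2 hb.ne_zero⟩
    ‖Shat b χ‖
      = ((b : ℝ) / (Real.pi * (Nat.totient (b ^ 2) : ℝ))) *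
          ‖DirichletCharacter.LFunction χ 1‖ * ‖SG b χ‖ := by
  have : NeZero (b ^ 2) := ⟨pow_ne_zero 2 hb.ne_zero⟩
  have hprim' : χ⁻¹.IsPrimitive := by
    rw [DirichletCharacter.isPrimitive_def, DirichletCharacter.conductor_inv]
    exact hprim
  have hstar (x : ZMod (b ^ 2)) : starRingEnd ℂ (χ x) = χ⁻¹ x := MulChar.star_apply' χ x
  have hSG : ‖SG b χ‖ =
      ‖∑ n ∈ diagSet b, (χ ((n + 1 : ℕ) : ZMod (b ^ 2)) - χ (n : ZMod (b ^ 2)))‖ := by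
    rw [SG, ← Complex.norm_conj]
    simp only [map_sum, map_sub, Complex.conj_conj]
  have hL := norm_LFunction_one_of_isPrimitive_of_odd hprim hodd
  have hsqrt : √((b ^ 2 : ℕ) : ℝ) = b := by
    rw [Nat.cast_pow, Real.sqrt_sq (Nat.cast_nonneg b)]
  rw [hsqrt] at hL
  have hφ : ((b ^ 2).totient : ℝ) ≠ 0 := by
    exact_mod_cast (Nat.totient_pos.mpr (NeZero.pos (b ^ 2))).ne'
  have hpi := Real.pi_ne_zero
  simp only [Shat, hstar]
  rw [sum_Scirc_mul hb hprim', sum_S_mul hb hprim', inv_inv, hSG, norm_mul, norm_mul, norm_neg,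
    norm_div, norm_one, Complex.norm_natCast]
  set K := ‖∑ x : ZMod (b ^ 2), (x.val : ℂ) / (b ^ 2 : ℕ) * χ⁻¹ x‖
  field_simp
  linear_combination -‖∑ n ∈ diagSet b, (χ ((n + 1 : ℕ) : ZMod (b ^ 2)) -
    χ (n : ZMod (b ^ 2)))‖ * hL
end

section
/- Let b be a prime and m = b². Then Σ_χ |Ŝ°(χ)|² = (1/φ(m))·Σ_a |S°(a)|², where the left sum runs over all primitive odd Dirichlet characters χ modulo m and the right sum runs over all a ∈ {0,…,m−1} with gcd(a,m) = 1; that is, in the Parseval identity for the group of units modulo m only the primitive odd characters contribute. -/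
open Finset
open scoped Classical

namespace Collision

/-- The reduced residues in `{0,…,b²−1}`. -/
def unitResidues (b : ℕ) : Finset ℕ :=
  (Finset.range (b ^ 2)).filter (fun a => Nat.gcd a (b ^ 2) = 1)

lemma mem_unitResidues {b a : ℕ} (hb : b.Prime) :
    a ∈ unitResidues b ↔ a < b ^ 2 ∧ ¬ b ∣ a := by
  have : Nat.gcd a (b ^ 2) = 1 ↔ ¬ b ∣ a := by
    rw [← Nat.coprime_iff_gcd_eq_one, Nat.coprime_pow_right_iff two_pos, Nat.coprime_comm,
      hb.coprime_iff_not_dvd]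
  rw [unitResidues, mem_filter, mem_range, this]

lemma mem_cosetUnits {b a a' : ℕ} :
    a' ∈ cosetUnits b a ↔ a' ∈ unitResidues b ∧ a' % b = a % b := by
  simp [cosetUnits, unitResidues, and_assoc]

lemma diagSet_eq_image {b : ℕ} (hb : 0 < b) :
    diagSet b = (Finset.range b).image (fun j => j * (b + 1)) := by
  ext n
  simp only [diagSet, mem_filter, mem_range, mem_image]
  constructor
  · rintro ⟨-, h⟩
    refine ⟨n % b, Nat.mod_lt _ hb, ?_⟩
    have := Nat.div_add_mod n b
    rw [h] at this
    linarith
  · rintro ⟨j, hj, rfl⟩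
    refine ⟨by nlinarith, ?_⟩
    rw [show j * (b + 1) = j + b * j by ring, Nat.add_mul_div_left _ _ hb,
      Nat.add_mul_mod_self_left, Nat.div_eq_of_lt hj, Nat.mod_eq_of_lt hj, zero_add]

lemma sum_diagSet {b : ℕ} (hb : 0 < b) (f : ℕ → ℤ) :
    ∑ n ∈ diagSet b, f n = ∑ j ∈ Finset.range b, f (j * (b + 1)) := by
  rw [diagSet_eq_image hb, Finset.sum_image]
  intro i _ j _ h
  exact Nat.eq_of_mul_eq_mul_right (Nat.succ_pos b) h

lemma mul_sub_div_add_mul_div {m a : ℕ} (hm : 0 < m) (ham : a ≤ m) (h : Nat.Coprime m a) (k : ℕ) :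
    ((k * (m - a) / m : ℕ) : ℤ) + ((k * a / m : ℕ) : ℤ) = k - 1 + if m ∣ k then 1 else 0 := by
  have hm0 : (m : ℤ) ≠ 0 := by exact_mod_cast hm.ne'
  push_cast [Nat.cast_sub ham]
  have e : (k : ℤ) * (m - a) = -(k * a) + k * m := by ring
  rw [e, Int.add_mul_ediv_right _ _ hm0]
  split_ifs with hk
  · obtain ⟨c, rfl⟩ := hk
    push_cast
    rw [show -((m : ℤ) * c * a) = m * (-(c * a)) by ring,
      show ((m : ℤ) * c * a) = m * (c * a) by ring,
      Int.mul_ediv_cancel_left _ hm0, Int.mul_ediv_cancel_left _ hm0]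
    ring
  · have hd : ¬ (m : ℤ) ∣ (k * a : ℤ) := by
      intro hd
      exact hk (h.dvd_of_dvd_mul_right (by exact_mod_cast hd))
    have h1 := Int.emod_add_mul_ediv ((k : ℤ) * a) m
    have h2 : 0 < ((k : ℤ) * a) % m := by
      have := Int.emod_nonneg ((k : ℤ) * a) hm0
      rcases this.lt_or_eq with h | h
      · exact h
      · exact absurd (Int.dvd_of_emod_eq_zero h.symm) hd
    have h3 := Int.emod_lt_of_pos ((k : ℤ) * a) (by exact_mod_cast hm : (0 : ℤ) < m)
    have h4 : (-((k : ℤ) * a)) / m = -((k : ℤ) * a / m) - 1 := by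
      rw [Int.ediv_eq_iff_of_pos (by exact_mod_cast hm)]
      constructor <;> nlinarith
    rw [h4]; ring

lemma S_sub {b a : ℕ} (hb : b.Prime) (ha : a ∈ unitResidues b) :
    S b (b ^ 2 - a) = -1 - S b a := by
  have hb0 := hb.pos
  obtain ⟨hlt, hnd⟩ := (mem_unitResidues hb).1 ha
  have hcop : Nat.Coprime b a := (hb.coprime_iff_not_dvd).2 hnd
  have hcop2 : Nat.Coprime (b ^ 2) a := hcop.pow_left 2
  have hfl : (((b ^ 2 - a) / b : ℕ) : ℤ) + ((a / b : ℕ) : ℤ) = b - 1 := by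
    have h1 : (b ^ 2 - a) / b = b - 1 - a / b := by
      have hd := Nat.div_add_mod a b
      have hm := Nat.mod_lt a hb0
      have hp : 0 < a % b := Nat.pos_of_ne_zero fun h => hnd (Nat.dvd_of_mod_eq_zero h)
      have hq : a / b < b := Nat.div_lt_of_lt_mul (by rwa [pow_two] at hlt)
      obtain ⟨c, hc⟩ : ∃ c, b = a / b + 1 + c := Nat.exists_eq_add_of_le hq
      have : b ^ 2 = b * (a / b) + b + b * c := by
        calc b ^ 2 = b * b := by ring
          _ = b * (a / b + 1 + c) := by rw [← hc]
          _ = _ := by ring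
      have e : b - 1 - a / b = c := by omega
      rw [e, Nat.div_eq_iff hb0, mul_comm c b]
      omega
    have hq : a / b < b := Nat.div_lt_of_lt_mul (by rwa [pow_two] at hlt)
    omega
  have hsum : ∑ n ∈ diagSet b, d b n (b ^ 2 - a) + ∑ n ∈ diagSet b, d b n a = b := by
    rw [← Finset.sum_add_distrib, sum_diagSet hb0]
    have key : ∀ j ∈ Finset.range b,
        d b (j * (b + 1)) (b ^ 2 - a) + d b (j * (b + 1)) a =
          1 + (if j = b - 1 then 1 else 0) - (if j = 0 then 1 else 0) := by
      intro j hj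
      have hj := Finset.mem_range.1 hj
      have h1 := mul_sub_div_add_mul_div (pow_pos hb0 2) hlt.le hcop2 (j * (b + 1) + 1)
      have h2 := mul_sub_div_add_mul_div (pow_pos hb0 2) hlt.le hcop2 (j * (b + 1))
      have i1 : b ^ 2 ∣ j * (b + 1) + 1 ↔ j = b - 1 := by
        constructor
        · intro h
          have := Nat.le_of_dvd (Nat.succ_pos _) h
          have : b ≤ j + 1 := by nlinarith
          omega
        · rintro rfl
          obtain ⟨c, rfl⟩ := Nat.exists_eq_succ_of_ne_zero hb0.ne'
          exact dvd_of_eq (by simp; ring)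
      have i2 : b ^ 2 ∣ j * (b + 1) ↔ j = 0 := by
        constructor
        · intro h
          by_contra h0
          have := Nat.le_of_dvd (by positivity) h
          nlinarith
        · rintro rfl; simp
      simp only [i1] at h1
      simp only [i2] at h2
      unfold d
      push_cast at h1 h2 ⊢
      linarith
    rw [Finset.sum_congr rfl key]
    have : b - 1 < b := by omega
    simp [Finset.sum_add_distrib, Finset.sum_sub_distrib, hb0, this, Finset.sum_ite_eq']
  unfold S
  linarith

lemma sub_mem_unitResidues {b a : ℕ} (hb : b.Prime) (ha : a ∈ unitResidues b) :
    b ^ 2 - a ∈ unitResidues b := by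
  rw [mem_unitResidues hb] at ha ⊢
  have h0 : 0 < a := Nat.pos_of_ne_zero fun h => ha.2 (h ▸ dvd_zero b)
  refine ⟨by omega, fun h => ha.2 ?_⟩
  exact (Nat.dvd_sub_iff_right ha.1.le (dvd_pow_self b two_ne_zero)).1 h

lemma sub_mem_cosetUnits {b a a' : ℕ} (hb : b.Prime) (ha : a ≤ b ^ 2)
    (h : a' ∈ cosetUnits b a) : b ^ 2 - a' ∈ cosetUnits b (b ^ 2 - a) := by
  rw [mem_cosetUnits] at h ⊢
  refine ⟨sub_mem_unitResidues hb h.1, ?_⟩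
  have hlt := ((mem_unitResidues hb).1 h.1).1
  have : a' ≡ a [MOD b] := h.2
  exact Nat.ModEq.sub hlt.le ha rfl this

lemma card_cosetUnits {b a : ℕ} (hb : b.Prime) (ha : a ∈ unitResidues b) :
    (cosetUnits b a).card = b := by
  have hb0 := hb.pos
  obtain ⟨-, hnd⟩ := (mem_unitResidues hb).1 ha
  have : cosetUnits b a = (Finset.range b).image (fun k => a % b + b * k) := by
    ext x
    simp only [mem_cosetUnits, mem_unitResidues hb, mem_image, mem_range]
    constructor
    · rintro ⟨⟨h1, -⟩, h3⟩
      refine ⟨x / b, Nat.div_lt_of_lt_mul (by rwa [pow_two] at h1), ?_⟩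
      rw [← h3, Nat.mod_add_div]
    · rintro ⟨k, hk, rfl⟩
      have hm := Nat.mod_lt a hb0
      refine ⟨⟨by nlinarith, fun h => hnd ?_⟩, by simp⟩
      rw [Nat.dvd_add_left (dvd_mul_right b k)] at h
      exact (Nat.dvd_mod_iff dvd_rfl).1 h
  rw [this, Finset.card_image_of_injective, card_range]
  intro i j h
  exact Nat.eq_of_mul_eq_mul_left hb0 (Nat.add_left_cancel h)

lemma Scirc_sub {b a : ℕ} (hb : b.Prime) (ha : a ∈ unitResidues b) :
    Scirc b (b ^ 2 - a) = -Scirc b a := by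
  have hlt := ((mem_unitResidues hb).1 ha).1
  have hb0 : (b : ℝ) ≠ 0 := by exact_mod_cast hb.ne_zero
  have hsum : ∑ x ∈ cosetUnits b (b ^ 2 - a), (S b x : ℝ) =
      ∑ x ∈ cosetUnits b a, (-1 - (S b x : ℝ)) := by
    refine (Finset.sum_nbij' (fun x => b ^ 2 - x) (fun x => b ^ 2 - x)
      (fun x hx => sub_mem_cosetUnits hb hlt.le hx) (fun x hx => ?_) (fun x hx => ?_)
      (fun x hx => ?_) (fun x hx => ?_)).symm
    · simpa [Nat.sub_sub_self hlt.le] using sub_mem_cosetUnits hb (Nat.sub_le _ _) hx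
    · exact Nat.sub_sub_self ((mem_unitResidues hb).1 (mem_cosetUnits.1 hx).1).1.le
    · exact Nat.sub_sub_self ((mem_unitResidues hb).1 (mem_cosetUnits.1 hx).1).1.le
    · rw [S_sub hb (mem_cosetUnits.1 hx).1]
      push_cast
      ring
  unfold Scirc
  rw [hsum, S_sub hb ha, Finset.sum_sub_distrib, Finset.sum_const, card_cosetUnits hb ha]
  push_cast
  field_simp
  rw [nsmul_eq_mul]
  ring

lemma sum_Scirc_mul_eq_zero {b : ℕ} (hb : b.Prime) (g : ℕ → ℂ)
    (hg : ∀ x ∈ unitResidues b, ∀ y ∈ unitResidues b, x % b = y % b → g x = g y) :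
    ∑ a ∈ unitResidues b, (Scirc b a : ℂ) * g a = 0 := by
  have hb0 : (b : ℂ) ≠ 0 := by exact_mod_cast hb.ne_zero
  have hswap : ∑ a ∈ unitResidues b, ∑ x ∈ cosetUnits b a, (S b x : ℂ) * g a =
      ∑ x ∈ unitResidues b, ∑ a ∈ cosetUnits b x, (S b x : ℂ) * g x := by
    rw [Finset.sum_comm' (s' := fun x => cosetUnits b x) (t' := unitResidues b)]
    · refine Finset.sum_congr rfl fun x hx => Finset.sum_congr rfl fun a ha => ?_
      rw [mem_cosetUnits] at ha
      rw [hg a ha.1 x hx ha.2]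
    · intro x y
      simp only [mem_cosetUnits]
      exact ⟨fun h => ⟨⟨h.1, h.2.2.symm⟩, h.2.1⟩, fun h => ⟨h.1.1, h.2, h.1.2.symm⟩⟩
  have hconst : ∑ x ∈ unitResidues b, ∑ a ∈ cosetUnits b x, (S b x : ℂ) * g x =
      b * ∑ x ∈ unitResidues b, (S b x : ℂ) * g x := by
    rw [Finset.mul_sum]
    refine Finset.sum_congr rfl fun x hx => ?_
    rw [Finset.sum_const, card_cosetUnits hb hx, nsmul_eq_mul]
  have hexp : ∀ a, (Scirc b a : ℂ) * g a =
      (S b a : ℂ) * g a - (1 / (b : ℂ)) * ∑ x ∈ cosetUnits b a, (S b x : ℂ) * g a := by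
    intro a
    rw [← Finset.sum_mul]
    unfold Scirc
    push_cast
    ring
  simp only [hexp]
  rw [Finset.sum_sub_distrib, ← Finset.mul_sum, hswap, hconst]
  field_simp
  simp

lemma sum_range_mul_char {b : ℕ} (χ : DirichletCharacter ℂ (b ^ 2)) (F : ℕ → ℂ) :
    ∑ a ∈ Finset.range (b ^ 2), F a * starRingEnd ℂ (χ (a : ZMod (b ^ 2))) =
      ∑ a ∈ unitResidues b, F a * starRingEnd ℂ (χ (a : ZMod (b ^ 2))) := by
  refine (Finset.sum_filter_of_ne fun a _ h => ?_).symm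
  by_contra hcop
  refine h ?_
  rw [χ.map_nonunit (by rwa [ZMod.isUnit_iff_coprime]), map_zero, mul_zero]

lemma Shat_eq_zero_of_not_odd {b : ℕ} (hb : b.Prime) (χ : DirichletCharacter ℂ (b ^ 2))
    (hχ : ¬ χ.Odd) : Shat b χ = 0 := by
  have heven : χ.Even := χ.even_or_odd.resolve_right hχ
  unfold Shat
  rw [sum_range_mul_char]
  have hneg : ∑ a ∈ unitResidues b, (Scirc b a : ℂ) * starRingEnd ℂ (χ (a : ZMod (b ^ 2))) =
      ∑ a ∈ unitResidues b, -((Scirc b a : ℂ) * starRingEnd ℂ (χ (a : ZMod (b ^ 2)))) := by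
    refine Finset.sum_nbij' (fun x => b ^ 2 - x) (fun x => b ^ 2 - x)
      (fun x hx => sub_mem_unitResidues hb hx) (fun x hx => sub_mem_unitResidues hb hx)
      (fun x hx => ?_) (fun x hx => ?_) (fun x hx => ?_)
    · exact Nat.sub_sub_self ((mem_unitResidues hb).1 hx).1.le
    · exact Nat.sub_sub_self ((mem_unitResidues hb).1 hx).1.le
    · rw [Scirc_sub hb hx, Nat.cast_sub ((mem_unitResidues hb).1 hx).1.le, ZMod.natCast_self,
        zero_sub, heven.eval_neg]
      push_cast
      ring
  rw [Finset.sum_neg_distrib, self_eq_neg] at hneg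
  rw [hneg, mul_zero]

lemma apply_eq_of_not_isPrimitive {b : ℕ} (hb : b.Prime) (χ : DirichletCharacter ℂ (b ^ 2))
    (hχ : ¬ χ.IsPrimitive) {x y : ℕ} (hx : x ∈ unitResidues b) (hy : y ∈ unitResidues b)
    (hxy : x % b = y % b) : χ (x : ZMod (b ^ 2)) = χ (y : ZMod (b ^ 2)) := by
  have hcb : χ.conductor ∣ b := by
    obtain ⟨k, hk, h⟩ := (Nat.dvd_prime_pow hb).1 χ.conductor_dvd_level
    have hk2 : k ≠ 2 := fun h2 => hχ (by rw [DirichletCharacter.isPrimitive_def, h, h2])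
    rw [h]
    exact (pow_dvd_pow b (by omega : k ≤ 1)).trans (by simp)
  obtain ⟨hd, χ₀, h⟩ := χ.factorsThrough_conductor
  have hval : ∀ z ∈ unitResidues b, χ (z : ZMod (b ^ 2)) = χ₀ (z : ZMod χ.conductor) := by
    intro z hz
    have hu : IsUnit (z : ZMod (b ^ 2)) := (ZMod.isUnit_iff_coprime _ _).2 (mem_filter.1 hz).2
    obtain ⟨u, hu⟩ := hu
    conv_lhs => rw [h]
    rw [← hu, DirichletCharacter.changeLevel_eq_cast_of_dvd, hu, ZMod.cast_natCast hd]
  rw [hval x hx, hval y hy, (ZMod.natCast_eq_natCast_iff _ _ _).2 (Nat.ModEq.of_dvd hcb hxy)]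

lemma Shat_eq_zero_of_not_isPrimitive {b : ℕ} (hb : b.Prime)
    (χ : DirichletCharacter ℂ (b ^ 2)) (hχ : ¬ χ.IsPrimitive) : Shat b χ = 0 := by
  unfold Shat
  rw [sum_range_mul_char, sum_Scirc_mul_eq_zero hb, mul_zero]
  intro x hx y hy hxy
  rw [apply_eq_of_not_isPrimitive hb χ hχ hx hy hxy]

lemma sum_conj_char_mul_char {n : ℕ} [NeZero n] {x : ZMod n} (hx : IsUnit x) (y : ZMod n) :
    ∑ χ : DirichletCharacter ℂ n, starRingEnd ℂ (χ x) * χ y =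
      if x = y then (n.totient : ℂ) else 0 := by
  have h := DirichletCharacter.sum_char_inv_mul_char_eq ℂ hx y
  rw [← h]
  refine Finset.sum_congr (by congr) fun χ _ => ?_
  congr 1
  have h1 : χ x⁻¹ * χ x = 1 := by
    rw [← map_mul, ZMod.inv_mul_of_unit x hx, map_one]
  have h2 : ‖χ x‖ = 1 := by
    obtain ⟨u, rfl⟩ := hx
    exact χ.unit_norm_eq_one u
  have h3 : starRingEnd ℂ (χ x) * χ x = 1 := by
    rw [mul_comm, Complex.mul_conj, Complex.normSq_eq_norm_sq, h2]
    simp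
  exact mul_right_cancel₀ (fun h0 => by simp [h0] at h1) (h3.trans h1.symm)

lemma sum_norm_Shat_sq {b : ℕ} (hb : b.Prime) :
    ∑ χ : DirichletCharacter ℂ (b ^ 2), ‖Shat b χ‖ ^ 2 =
      (1 / (Nat.totient (b ^ 2) : ℝ)) * ∑ a ∈ unitResidues b, |Scirc b a| ^ 2 := by
  have : NeZero (b ^ 2) := ⟨pow_ne_zero 2 hb.ne_zero⟩
  have hφ : (Nat.totient (b ^ 2) : ℂ) ≠ 0 := by
    exact_mod_cast (Nat.totient_pos.2 (pow_pos hb.pos 2)).ne'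
  apply Complex.ofReal_injective
  push_cast
  have hterm : ∀ χ : DirichletCharacter ℂ (b ^ 2), ((‖Shat b χ‖ : ℝ) : ℂ) ^ 2 =
      (1 / (Nat.totient (b ^ 2) : ℂ)) ^ 2 * ∑ x ∈ unitResidues b, ∑ y ∈ unitResidues b,
        (Scirc b x : ℂ) * Scirc b y *
          (starRingEnd ℂ (χ (x : ZMod (b ^ 2))) * χ (y : ZMod (b ^ 2))) := by
    intro χ
    rw [← Complex.mul_conj']
    unfold Shat
    rw [sum_range_mul_char, map_mul, map_sum]
    simp only [map_mul, map_div₀, map_one, map_natCast, Complex.conj_conj, Complex.conj_ofReal]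
    rw [mul_mul_mul_comm, Finset.sum_mul_sum, ← pow_two]
    congr 1
    refine Finset.sum_congr rfl fun x _ => Finset.sum_congr rfl fun y _ => ?_
    ring
  rw [Finset.sum_congr rfl fun χ _ => hterm χ, ← Finset.mul_sum, Finset.sum_comm]
  have hinner : ∀ x ∈ unitResidues b,
      ∑ χ : DirichletCharacter ℂ (b ^ 2), ∑ y ∈ unitResidues b,
        (Scirc b x : ℂ) * Scirc b y *
          (starRingEnd ℂ (χ (x : ZMod (b ^ 2))) * χ (y : ZMod (b ^ 2))) =
      (Nat.totient (b ^ 2) : ℂ) * (|Scirc b x| : ℝ) ^ 2 := by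
    intro x hx
    rw [Finset.sum_comm]
    have hu : IsUnit (x : ZMod (b ^ 2)) := (ZMod.isUnit_iff_coprime _ _).2 (mem_filter.1 hx).2
    simp only [← Finset.mul_sum, sum_conj_char_mul_char hu]
    rw [Finset.sum_eq_single_of_mem x hx]
    · rw [if_pos rfl, ← Complex.ofReal_pow, sq_abs]
      push_cast
      ring
    · intro y hy hyx
      rw [if_neg, mul_zero]
      intro h
      rw [ZMod.natCast_eq_natCast_iff'] at h
      rw [Nat.mod_eq_of_lt ((mem_unitResidues hb).1 hx).1,
        Nat.mod_eq_of_lt ((mem_unitResidues hb).1 hy).1] at h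
      exact hyx h.symm
  rw [Finset.sum_congr rfl hinner, ← Finset.mul_sum]
  field_simp

end Collision

open Collision in
theorem stmt13 (b : ℕ) (hb : b.Prime) :
    ∑ χ ∈ Finset.univ.filter
        (fun χ : DirichletCharacter ℂ (b ^ 2) => χ.IsPrimitive ∧ χ.Odd),
        ‖Shat b χ‖ ^ 2
      = (1 / (Nat.totient (b ^ 2) : ℝ)) *
          ∑ a ∈ (Finset.range (b ^ 2)).filter (fun a => Nat.gcd a (b ^ 2) = 1),
            |Scirc b a| ^ 2 := by
  rw [Finset.sum_filter_of_ne, sum_norm_Shat_sq hb]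
  · rfl
  · intro χ _ h
    constructor
    · by_contra hχ
      exact h (by simp [Shat_eq_zero_of_not_isPrimitive hb χ hχ])
    · by_contra hχ
      exact h (by simp [Shat_eq_zero_of_not_odd hb χ hχ])
end

section
/- For every primitive odd Dirichlet character χ modulo 25, the short partial sum satisfies |Σ_{k=1}^{4} χ̄(k)| = (√5/2)·|B_{1,χ̄}|, where B_{1,χ̄} = (1/25)·Σ_{a=0}^{24} a·χ̄(a). -/
open Finset
open scoped Classical

namespace Collision

/-- Since `2` generates the units modulo `25`, the values of `χ` are powers of `χ 2`. -/
lemma apply_natCast_eq_pow (χ : DirichletCharacter ℂ (5 ^ 2)) {a : ℕ} (j : ℕ)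
    (h : 2 ^ j % 5 ^ 2 = a % 5 ^ 2) :
    χ (a : ZMod (5 ^ 2)) = χ ((2 : ℕ) : ZMod (5 ^ 2)) ^ j := by
  rw [← map_pow, ← Nat.cast_pow, (ZMod.natCast_eq_natCast_iff _ _ _).mpr h]

lemma apply_natCast_eq_zero (χ : DirichletCharacter ℂ (5 ^ 2)) {a : ℕ} (h : 5 ∣ a) :
    χ (a : ZMod (5 ^ 2)) = 0 := by
  apply χ.map_nonunit
  rw [ZMod.isUnit_iff_coprime, Nat.coprime_pow_right_iff (by norm_num)]
  exact fun hc => absurd (Nat.eq_one_of_dvd_coprimes hc h dvd_rfl) (by norm_num)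

lemma apply_two_pow_ten (χ : DirichletCharacter ℂ (5 ^ 2)) (hodd : χ.Odd) :
    χ ((2 : ℕ) : ZMod (5 ^ 2)) ^ 10 = -1 := by
  rw [← apply_natCast_eq_pow χ (a := 24) 10 (by norm_num), ← hodd]
  congr 1

lemma factorsThrough_five (χ : DirichletCharacter ℂ (5 ^ 2))
    (h : χ ((2 : ℕ) : ZMod (5 ^ 2)) ^ 4 = 1) : χ.FactorsThrough 5 := by
  rw [DirichletCharacter.factorsThrough_iff_ker_unitsMap (dvd_pow_self 5 two_ne_zero)]
  intro u hu
  rw [MonoidHom.mem_ker, Units.ext_iff, ZMod.unitsMap_val, Units.val_one,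
    ← ZMod.natCast_zmod_val (u : ZMod (5 ^ 2)), ZMod.cast_natCast (dvd_pow_self 5 two_ne_zero),
    ← Nat.cast_one, ZMod.natCast_eq_natCast_iff] at hu
  rw [MonoidHom.mem_ker, Units.ext_iff, MulChar.coe_toUnitHom, Units.val_one,
    ← ZMod.natCast_zmod_val (u : ZMod (5 ^ 2))]
  have hlt : (u : ZMod (5 ^ 2)).val < 25 := ZMod.val_lt _
  have hmod : (u : ZMod (5 ^ 2)).val % 5 = 1 := hu
  obtain ⟨j, hj⟩ : ∃ j, 2 ^ (4 * j) % 5 ^ 2 = (u : ZMod (5 ^ 2)).val % 5 ^ 2 := by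
    have : (u : ZMod (5 ^ 2)).val = 1 ∨ (u : ZMod (5 ^ 2)).val = 6 ∨
        (u : ZMod (5 ^ 2)).val = 11 ∨ (u : ZMod (5 ^ 2)).val = 16 ∨
        (u : ZMod (5 ^ 2)).val = 21 := by omega
    rcases this with h | h | h | h | h <;> rw [h]
    exacts [⟨0, rfl⟩, ⟨2, rfl⟩, ⟨4, rfl⟩, ⟨1, rfl⟩, ⟨3, rfl⟩]
  rw [apply_natCast_eq_pow χ _ hj, pow_mul, h, one_pow]

lemma apply_two_pow_four_ne_one (χ : DirichletCharacter ℂ (5 ^ 2)) (hprim : χ.IsPrimitive) :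
    χ ((2 : ℕ) : ZMod (5 ^ 2)) ^ 4 ≠ 1 := by
  intro h
  have hle : χ.conductor ≤ 5 := Nat.sInf_le (factorsThrough_five χ h)
  rw [(DirichletCharacter.isPrimitive_def χ).mp hprim] at hle
  norm_num at hle

/-- `χ 2` is a root of the twentieth cyclotomic polynomial. -/
lemma cyclotomic_relation {z : ℂ} (h10 : z ^ 10 = -1) (h4 : z ^ 4 ≠ 1) :
    z ^ 8 - z ^ 6 + z ^ 4 - z ^ 2 + 1 = 0 := by
  have hne : z ^ 2 + 1 ≠ 0 := fun h => h4 (by linear_combination (z ^ 2 - 1) * h)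
  refine (mul_eq_zero.mp ?_).resolve_left hne
  linear_combination h10

lemma conj_eq_neg_pow_nine {z : ℂ} (h10 : z ^ 10 = -1) : starRingEnd ℂ z = -z ^ 9 := by
  have hnorm : ‖z‖ = 1 := by
    have h := congrArg norm h10
    rw [norm_pow, norm_neg, norm_one] at h
    exact (pow_eq_one_iff_of_nonneg (norm_nonneg z) (by norm_num)).mp h
  rw [← Complex.inv_eq_conj hnorm]
  exact inv_eq_of_mul_eq_one_right (by linear_combination -h10)

lemma five_mul_norm_sq_eq {z : ℂ} (h10 : z ^ 10 = -1)
    (h : z ^ 8 - z ^ 6 + z ^ 4 - z ^ 2 + 1 = 0) :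
    5 * ‖1 + z + z ^ 2 + z ^ 7‖ ^ 2 =
      ‖1 + 2 * z + 3 * z ^ 2 + z ^ 3 - 2 * z ^ 4 + z ^ 5 + z ^ 6 + 2 * z ^ 7‖ ^ 2 := by
  have hpow (k : ℕ) (hk : k < 9) : (-z ^ 9) ^ (k + 1) = -z ^ (9 - k) := by
    induction k with
    | zero => simp
    | succ k ih =>
      rw [pow_succ, ih (by omega), show 9 - k = (9 - (k + 1)) + 1 by omega]
      linear_combination z ^ (9 - (k + 1)) * h10
  apply Complex.ofReal_injective
  push_cast
  rw [← Complex.mul_conj', ← Complex.mul_conj']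
  simp only [map_add, map_sub, map_mul, map_pow, map_one, map_ofNat, conj_eq_neg_pow_nine h10]
  rw [hpow 1 (by norm_num), hpow 2 (by norm_num), hpow 3 (by norm_num), hpow 4 (by norm_num),
    hpow 5 (by norm_num), hpow 6 (by norm_num)]
  linear_combination
    (4 + 3 * z + 6 * z ^ 2 - z ^ 3 + 4 * z ^ 4 - z ^ 5 + 6 * z ^ 6 + 3 * z ^ 7 - z ^ 8) * h

lemma sum_Icc_eq (χ : DirichletCharacter ℂ (5 ^ 2)) {z : ℂ}
    (hz : χ ((2 : ℕ) : ZMod (5 ^ 2)) = z) :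
    ∑ k ∈ Finset.Icc (1 : ℕ) 4, starRingEnd ℂ (χ (k : ZMod (5 ^ 2))) =
      starRingEnd ℂ (1 + z + z ^ 2 + z ^ 7) := by
  rw [← map_sum, Finset.sum_Icc_succ_top (by norm_num), Finset.sum_Icc_succ_top (by norm_num),
    Finset.sum_Icc_succ_top (by norm_num), Finset.Icc_self, Finset.sum_singleton,
    apply_natCast_eq_pow χ 0 (by norm_num), apply_natCast_eq_pow χ (a := 1 + 1) 1 (by norm_num),
    apply_natCast_eq_pow χ (a := 1 + 1 + 1) 7 (by norm_num),
    apply_natCast_eq_pow χ (a := 1 + 1 + 1 + 1) 2 (by norm_num), hz]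
  ring_nf

lemma B1bar_five_eq (χ : DirichletCharacter ℂ (5 ^ 2)) {z : ℂ}
    (hz : χ ((2 : ℕ) : ZMod (5 ^ 2)) = z)
    (h : z ^ 8 - z ^ 6 + z ^ 4 - z ^ 2 + 1 = 0) :
    B1bar 5 χ = starRingEnd ℂ (-(2 / 5) *
      (1 + 2 * z + 3 * z ^ 2 + z ^ 3 - 2 * z ^ 4 + z ^ 5 + z ^ 6 + 2 * z ^ 7)) := by
  have hsum : ∑ a ∈ Finset.range (5 ^ 2), (a : ℂ) * χ (a : ZMod (5 ^ 2)) =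
      -10 * (1 + 2 * z + 3 * z ^ 2 + z ^ 3 - 2 * z ^ 4 + z ^ 5 + z ^ 6 + 2 * z ^ 7) := by
    change ∑ a ∈ Finset.range 25, (a : ℂ) * χ (a : ZMod (5 ^ 2)) = _
    simp only [Finset.sum_range_succ, Finset.sum_range_zero]
    rw [apply_natCast_eq_zero χ (a := 0) (by norm_num),
      apply_natCast_eq_zero χ (a := 5) (by norm_num),
      apply_natCast_eq_zero χ (a := 10) (by norm_num),
      apply_natCast_eq_zero χ (a := 15) (by norm_num),
      apply_natCast_eq_zero χ (a := 20) (by norm_num),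
      apply_natCast_eq_pow χ (a := 1) 0 (by norm_num),
      apply_natCast_eq_pow χ (a := 2) 1 (by norm_num),
      apply_natCast_eq_pow χ (a := 3) 7 (by norm_num),
      apply_natCast_eq_pow χ (a := 4) 2 (by norm_num),
      apply_natCast_eq_pow χ (a := 6) 8 (by norm_num),
      apply_natCast_eq_pow χ (a := 7) 5 (by norm_num),
      apply_natCast_eq_pow χ (a := 8) 3 (by norm_num),
      apply_natCast_eq_pow χ (a := 9) 14 (by norm_num),
      apply_natCast_eq_pow χ (a := 11) 16 (by norm_num),
      apply_natCast_eq_pow χ (a := 12) 9 (by norm_num),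
      apply_natCast_eq_pow χ (a := 13) 19 (by norm_num),
      apply_natCast_eq_pow χ (a := 14) 6 (by norm_num),
      apply_natCast_eq_pow χ (a := 16) 4 (by norm_num),
      apply_natCast_eq_pow χ (a := 17) 13 (by norm_num),
      apply_natCast_eq_pow χ (a := 18) 15 (by norm_num),
      apply_natCast_eq_pow χ (a := 19) 18 (by norm_num),
      apply_natCast_eq_pow χ (a := 21) 12 (by norm_num),
      apply_natCast_eq_pow χ (a := 22) 17 (by norm_num),
      apply_natCast_eq_pow χ (a := 23) 11 (by norm_num),
      apply_natCast_eq_pow χ (a := 24) 10 (by norm_num), hz]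
    push_cast
    linear_combination (11 + 22 * z + 45 * z ^ 2 + 40 * z ^ 3 + 30 * z ^ 4 + 35 * z ^ 5 +
      20 * z ^ 6 + 40 * z ^ 7 + 30 * z ^ 8 + 35 * z ^ 9 + 19 * z ^ 10 + 13 * z ^ 11) * h
  have hconj : ∑ a ∈ Finset.range (5 ^ 2), (a : ℂ) * starRingEnd ℂ (χ (a : ZMod (5 ^ 2))) =
      starRingEnd ℂ (∑ a ∈ Finset.range (5 ^ 2), (a : ℂ) * χ (a : ZMod (5 ^ 2))) := by
    simp only [map_sum, map_mul, Complex.conj_natCast]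
  rw [B1bar, hconj, hsum]
  simp only [map_mul, map_neg, map_div₀, map_ofNat]
  push_cast
  ring

end Collision

open Collision in
theorem stmt16 (χ : DirichletCharacter ℂ (5 ^ 2)) (hprim : χ.IsPrimitive) (hodd : χ.Odd) :
    ‖∑ k ∈ Finset.Icc (1 : ℕ) 4, starRingEnd ℂ (χ (k : ZMod (5 ^ 2)))‖
      = (Real.sqrt 5 / 2) * ‖B1bar 5 χ‖ := by
  have h10 := apply_two_pow_ten χ hodd
  have hcyc := cyclotomic_relation h10 (apply_two_pow_four_ne_one χ hprim)
  have hnorm := five_mul_norm_sq_eq h10 hcyc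
  rw [sum_Icc_eq χ rfl, B1bar_five_eq χ rfl hcyc, Complex.norm_conj, Complex.norm_conj, norm_mul,
    norm_neg]
  have hc : ‖(2 / 5 : ℂ)‖ = 2 / 5 := by norm_num
  rw [hc, ← sq_eq_sq₀ (by positivity) (by positivity), mul_pow, mul_pow, div_pow,
    Real.sq_sqrt (by norm_num)]
  linear_combination hnorm / 5
end

section
/- For every primitive odd Dirichlet character χ modulo 25, the Fourier coefficient of the centered collision invariant satisfies |Ŝ°(χ)| = (5√5/(4π²))·|L(1,χ)|², where L(1,χ) is the value of the Dirichlet L-function of χ at s = 1. -/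
open Finset
open scoped Classical

open Filter Topology

theorem rpow_neg_sub_rpow_neg_le {u v s : ℝ} (hu : 0 < u) (huv : u ≤ v) (h1 : v ≤ u + 1)
    (hs : 1 ≤ s) (hs2 : s ≤ 2) : |u ^ (-s) - v ^ (-s)| ≤ 2 * (1 / u ^ 2 + 1 / u ^ 3) := by
  have hv : 0 < v := hu.trans_le huv
  have hle : v ^ (-s) ≤ u ^ (-s) := Real.rpow_le_rpow_of_nonpos hu huv (by linarith)
  rw [abs_of_nonneg (sub_nonneg.2 hle)]
  have hb := one_add_mul_self_le_rpow_one_add (s := u / v - 1) (by linarith [div_pos hu hv]) hs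
  have hvs : v ^ (-s) = u ^ (-s) * (u / v) ^ s := by
    rw [Real.div_rpow hu.le hv.le, Real.rpow_neg hu.le, Real.rpow_neg hv.le]
    have := (Real.rpow_pos_of_pos hu s).ne'
    field_simp
  rw [add_sub_cancel] at hb
  have hus : 0 < u ^ (-s) := Real.rpow_pos_of_pos hu _
  have hus' : u ^ (-s) ≤ 1 / u + 1 / u ^ 2 := by
    rcases le_total u 1 with h | h
    · have := Real.rpow_le_rpow_of_exponent_ge hu h (show -2 ≤ -s by linarith)
      rw [Real.rpow_neg hu.le 2, Real.rpow_two] at this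
      have : 0 < 1 / u := by positivity
      rw [one_div (u ^ 2)]; linarith
    · have := Real.rpow_le_rpow_of_exponent_le h (show -s ≤ -1 by linarith)
      rw [Real.rpow_neg_one] at this
      have : 0 < 1 / u ^ 2 := by positivity
      rw [one_div u]; linarith
  have hvu : 1 - u / v ≤ 1 / u := by
    rw [one_sub_div hv.ne', div_le_div_iff₀ hv hu]
    nlinarith
  have h0 : 0 ≤ 1 - u / v := sub_nonneg.2 ((div_le_one hv).2 huv)
  calc u ^ (-s) - v ^ (-s) = u ^ (-s) * (1 - (u / v) ^ s) := by rw [hvs]; ring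
    _ ≤ u ^ (-s) * (2 * (1 - u / v)) := by
        gcongr
        nlinarith
    _ ≤ (1 / u + 1 / u ^ 2) * (2 * (1 / u)) := by gcongr
    _ = _ := by field_simp

theorem abs_rpow_neg_sub_rpow_neg_le {u v s : ℝ} (hu : 0 < u) (hv : 0 < v) (h : |u - v| ≤ 1)
    (hs : 1 ≤ s) (hs2 : s ≤ 2) :
    |u ^ (-s) - v ^ (-s)| ≤ 2 * (1 / u ^ 2 + 1 / u ^ 3) + 2 * (1 / v ^ 2 + 1 / v ^ 3) := by
  have hu' : 0 ≤ 2 * (1 / u ^ 2 + 1 / u ^ 3) := by positivity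
  have hv' : 0 ≤ 2 * (1 / v ^ 2 + 1 / v ^ 3) := by positivity
  obtain ⟨h₁, h₂⟩ := abs_le.1 h
  rcases le_total u v with huv | huv
  · linarith [rpow_neg_sub_rpow_neg_le hu huv (by linarith) hs hs2]
  · rw [abs_sub_comm]
    linarith [rpow_neg_sub_rpow_neg_le hv huv (by linarith) hs hs2]

theorem summable_one_div_natCast_add_pow {a : ℝ} (ha : 0 < a) {k : ℕ} (hk : 1 < k) :
    Summable fun n : ℕ ↦ 1 / ((n : ℝ) + a) ^ k := by
  refine ((Real.summable_one_div_nat_add_rpow a k).2 (by exact_mod_cast hk)).congr fun n ↦ ?_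
  rw [abs_of_pos (by positivity), Real.rpow_natCast]

theorem tendsto_sum_one_div_sub_one_div {x : ℝ} (hx : x ∈ Set.Ioo 0 1) :
    Tendsto (fun M : ℕ ↦ ∑ n ∈ Finset.range M, (1 / (n + x : ℂ) - 1 / (n + 1 - x : ℂ))) atTop
      (𝓝 (Real.pi * Complex.cot (Real.pi * x))) := by
  have hxc : (x : ℂ) ∈ Complex.integerComplement := by
    rintro ⟨k, hk⟩
    have hk' : (k : ℝ) = x := by exact_mod_cast hk
    have h₀ : (0 : ℝ) < k := hk' ▸ hx.1
    have h₁ : (k : ℝ) < 1 := hk' ▸ hx.2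
    norm_cast at h₀ h₁
    omega
  have hlim : Tendsto (fun M : ℕ ↦ 1 / (x : ℂ) - 1 / (M + x : ℂ)) atTop (𝓝 (1 / (x : ℂ) - 0)) := by
    refine tendsto_const_nhds.sub ?_
    have : Tendsto (fun M : ℕ ↦ (M : ℝ) + x) atTop atTop :=
      tendsto_atTop_add_const_right _ _ tendsto_natCast_atTop_atTop
    have := (Complex.continuous_ofReal.tendsto 0).comp this.inv_tendsto_atTop
    simpa [Function.comp_def] using this
  convert! (tendsto_logDeriv_euler_cot_sub hxc).add hlim using 2 with M
  · induction M with
    | zero => simp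
    | succ M ih =>
      rw [Finset.sum_range_succ, Finset.sum_range_succ, ih, cotTerm]
      rw [show (x - (M + 1) : ℂ) = -(M + 1 - x) by ring, div_neg]
      push_cast
      ring
  · ring

theorem hurwitzZetaOdd_apply_one {x : ℝ} (hx : x ∈ Set.Ioo 0 1) :
    HurwitzZeta.hurwitzZetaOdd (x : UnitAddCircle) 1
      = Real.pi / 2 * Complex.cot (Real.pi * x) := by
  have hpos (n : ℕ) : 0 < n + x ∧ 0 < n + (1 - x) :=
    ⟨by linarith [hx.1, n.cast_nonneg (α := ℝ)], by linarith [hx.2, n.cast_nonneg (α := ℝ)]⟩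
  have habs (n : ℕ) : |(n + x) - (n + (1 - x))| ≤ 1 :=
    abs_le.2 ⟨by linarith [hx.1], by linarith [hx.2]⟩
  set bound : ℕ → ℝ := fun n ↦ 2 * (1 / (n + x) ^ 2 + 1 / (n + x) ^ 3)
    + 2 * (1 / (n + (1 - x)) ^ 2 + 1 / (n + (1 - x)) ^ 3)
  have hbound : Summable bound := by
    have h1x : 0 < 1 - x := by linarith [hx.2]
    have hsum {a : ℝ} (ha : 0 < a) :
        Summable fun n : ℕ ↦ 2 * (1 / ((n : ℝ) + a) ^ 2 + 1 / ((n : ℝ) + a) ^ 3) :=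
      ((summable_one_div_natCast_add_pow ha one_lt_two).add
        (summable_one_div_natCast_add_pow ha (by norm_num))).mul_left 2
    exact (hsum hx.1).add (hsum h1x)
  set f : ℝ → ℕ → ℝ := fun s n ↦ (n + x) ^ (-s) - (n + (1 - x)) ^ (-s)
  have hf {s : ℝ} (hs : 1 ≤ s) (hs2 : s ≤ 2) (n : ℕ) : ‖f s n‖ ≤ bound n :=
    abs_rpow_neg_sub_rpow_neg_le (hpos n).1 (hpos n).2 (habs n) hs hs2
  have hf1 : Summable (f 1) := hbound.of_norm_bounded (hf le_rfl one_le_two)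
  have hlim : Tendsto (fun s ↦ ∑' n, f s n) (𝓝[>] 1) (𝓝 (∑' n, f 1 n)) := by
    refine tendsto_tsum_of_dominated_convergence hbound (fun n ↦ ?_) ?_
    · have : ContinuousAt (fun s ↦ f s n) 1 :=
        (continuousAt_const.rpow continuousAt_neg (.inl (hpos n).1.ne')).sub
          (continuousAt_const.rpow continuousAt_neg (.inl (hpos n).2.ne'))
      exact this.tendsto.mono_left nhdsWithin_le_nhds
    · filter_upwards [Ioc_mem_nhdsGT one_lt_two] with s hs using hf hs.1.le hs.2
  have hseries : Tendsto (fun s : ℝ ↦ HurwitzZeta.hurwitzZetaOdd (x : UnitAddCircle) (s : ℂ))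
      (𝓝[>] 1) (𝓝 (((∑' n, f 1 n : ℝ) : ℂ) / 2)) := by
    refine (((Complex.continuous_ofReal.tendsto _).comp hlim).div_const 2).congr' ?_
    filter_upwards [self_mem_nhdsWithin] with s hs
    have := (HurwitzZeta.hasSum_nat_hurwitzZetaOdd_of_mem_Icc (a := x) ⟨hx.1.le, hx.2.le⟩
      (s := s) (by simpa using hs)).tsum_eq
    rw [← this, tsum_div_const, Function.comp_apply, Complex.ofReal_tsum]
    congr 2 with n
    simp only [f, Complex.ofReal_sub, Complex.ofReal_cpow (hpos n).1.le,
      Complex.ofReal_cpow (hpos n).2.le, Complex.ofReal_neg, Complex.cpow_neg, one_div]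
    push_cast
    ring_nf
  have hcont : Tendsto (fun s : ℝ ↦ HurwitzZeta.hurwitzZetaOdd (x : UnitAddCircle) (s : ℂ))
      (𝓝[>] 1) (𝓝 (HurwitzZeta.hurwitzZetaOdd (x : UnitAddCircle) 1)) := by
    have := ((HurwitzZeta.differentiable_hurwitzZetaOdd (x : UnitAddCircle)).continuous.comp
      Complex.continuous_ofReal).tendsto 1
    simpa [Function.comp_def] using this.mono_left nhdsWithin_le_nhds
  have hcot : ((∑' n, f 1 n : ℝ) : ℂ) = Real.pi * Complex.cot (Real.pi * x) := by
    refine tendsto_nhds_unique ?_ (tendsto_sum_one_div_sub_one_div hx)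
    refine ((Complex.continuous_ofReal.tendsto _).comp hf1.hasSum.tendsto_sum_nat).congr fun M ↦ ?_
    simp [f, Real.rpow_neg_one, add_sub_assoc]
  rw [tendsto_nhds_unique hcont hseries, hcot]
  ring

open ZMod in
theorem ZMod.LFunction_apply_one_of_odd {N : ℕ} [NeZero N] {Φ : ZMod N → ℂ} (hΦ : Φ.Odd) :
    ZMod.LFunction Φ 1
      = Real.pi / (2 * N) * ∑ j, Φ j * Complex.cot (Real.pi * (j.val / N)) := by
  have hN : (0 : ℝ) < N := by exact_mod_cast NeZero.pos N
  rw [LFunction_def_odd hΦ, Complex.cpow_neg_one, Finset.mul_sum, Finset.mul_sum]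
  refine Finset.sum_congr rfl fun j _ ↦ ?_
  rcases eq_or_ne j 0 with rfl | hj
  · simp [hΦ.map_zero]
  · have hval : (0 : ℝ) < j.val := by
      exact_mod_cast Nat.pos_of_ne_zero (by simpa [ZMod.val_eq_zero] using hj)
    rw [toAddCircle_apply, hurwitzZetaOdd_apply_one
      ⟨by positivity, (div_lt_one hN).2 (by exact_mod_cast j.val_lt)⟩]
    push_cast
    field_simp

theorem sum_range_natCast_mul_pow_mul_sub_one {R : Type*} [CommRing R] (w : R) (n : ℕ) :
    (∑ r ∈ Finset.range n, (r : R) * w ^ r) * (w - 1)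
      = n * w ^ n - w * ∑ r ∈ Finset.range n, w ^ r := by
  induction n with
  | zero => simp
  | succ n ih =>
    rw [Finset.sum_range_succ, Finset.sum_range_succ, add_mul, ih]
    push_cast
    ring

theorem ZMod.sum_val_eq_sum_range {N : ℕ} [NeZero N] {M : Type*} [AddCommMonoid M] (f : ℕ → M) :
    ∑ r : ZMod N, f r.val = ∑ r ∈ Finset.range N, f r :=
  Finset.sum_nbij' ZMod.val (fun r ↦ (r : ZMod N)) (fun r _ ↦ Finset.mem_range.2 r.val_lt)
    (fun _ _ ↦ Finset.mem_univ _) (fun r _ ↦ r.natCast_zmod_val)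
    (fun _ hr ↦ ZMod.val_cast_of_lt (Finset.mem_range.1 hr)) (fun _ _ ↦ rfl)

open ZMod in
theorem ZMod.cot_pi_mul_val_div {N : ℕ} [NeZero N] {j : ZMod N} (hj : j ≠ 0) :
    Complex.cot (Real.pi * (j.val / N))
      = Complex.I * (1 + 2 / N * ∑ r : ZMod N, (r.val : ℂ) * stdAddChar (r * j)) := by
  have hN : (N : ℂ) ≠ 0 := NeZero.ne _
  set w : ℂ := stdAddChar j
  have hw (r : ZMod N) : stdAddChar (r * j) = w ^ r.val := by
    rw [← AddChar.map_nsmul_eq_pow, nsmul_eq_mul, natCast_zmod_val]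
  have hwN : w ^ N = 1 := by
    rw [← AddChar.map_nsmul_eq_pow, nsmul_eq_mul, CharP.cast_eq_zero, zero_mul,
      AddChar.map_zero_eq_one]
  have hw1 : w - 1 ≠ 0 := by
    rw [sub_ne_zero, ← AddChar.map_zero_eq_one (stdAddChar (N := N))]
    exact fun h ↦ hj (injective_stdAddChar h)
  have hgeom : ∑ r ∈ Finset.range N, w ^ r = 0 := by
    have := geom_sum_mul w N
    rwa [hwN, sub_self, mul_eq_zero, or_iff_left hw1] at this
  have hsum : (∑ r : ZMod N, (r.val : ℂ) * stdAddChar (r * j)) = N / (w - 1) := by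
    simp only [hw]
    rw [sum_val_eq_sum_range fun r ↦ (r : ℂ) * w ^ r, eq_div_iff hw1,
      sum_range_natCast_mul_pow_mul_sub_one, hgeom, hwN]
    ring
  have hexp : Complex.exp (2 * Real.pi * Complex.I * (j.val / N)) = w := by
    rw [← mul_div_assoc, ← toCircle_apply, ← stdAddChar_apply]
  have hw1' : 1 - w ≠ 0 := by rwa [← neg_sub, neg_ne_zero]
  rw [Complex.cot_pi_eq_exp_ratio, hexp, hsum, div_eq_iff (mul_ne_zero Complex.I_ne_zero hw1')]
  field_simp
  rw [Complex.I_sq]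
  ring

open ZMod DirichletCharacter in
theorem DirichletCharacter.LFunction_apply_one_of_odd {N : ℕ} [NeZero N]
    {χ : DirichletCharacter ℂ N} (hodd : χ.Odd) (hprim : χ.IsPrimitive) :
    LFunction χ 1 = Real.pi * Complex.I * gaussSum χ stdAddChar / N ^ 2 *
      ∑ r : ZMod N, (r.val : ℂ) * χ⁻¹ r := by
  have hχ : χ ≠ 1 := by
    rintro rfl
    have h : (1 : DirichletCharacter ℂ N) (-1) = -1 := hodd
    rw [MulChar.one_apply isUnit_one.neg] at h
    norm_num at h
  have hcot (j : ZMod N) : χ j * Complex.cot (Real.pi * (j.val / N)) = Complex.I * (χ j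
      + 2 / N * ∑ r : ZMod N, (r.val : ℂ) * (χ j * stdAddChar (r * j))) := by
    rcases eq_or_ne j 0 with rfl | hj
    · simp [hodd.to_fun.map_zero]
    · rw [ZMod.cot_pi_mul_val_div hj, Finset.mul_sum, Finset.mul_sum]
      simp only [Finset.mul_sum, mul_add]
      congr 1
      · ring
      · exact Finset.sum_congr rfl fun r _ ↦ by ring
  have hN : (N : ℂ) ≠ 0 := NeZero.ne _
  have hgauss (r : ZMod N) : ∑ j, χ j * stdAddChar (r * j) = χ⁻¹ r * gaussSum χ stdAddChar :=
    gaussSum_mulShift_of_isPrimitive stdAddChar hprim r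
  rw [LFunction, ZMod.LFunction_apply_one_of_odd hodd.to_fun]
  have hdouble : ∑ j, ∑ r : ZMod N, (r.val : ℂ) * (χ j * stdAddChar (r * j))
      = (∑ r : ZMod N, (r.val : ℂ) * χ⁻¹ r) * gaussSum χ stdAddChar := by
    rw [Finset.sum_comm, Finset.sum_mul]
    exact Finset.sum_congr rfl fun r _ ↦ by rw [← Finset.mul_sum, hgauss, mul_assoc]
  simp only [hcot]
  rw [← Finset.mul_sum, Finset.sum_add_distrib, MulChar.sum_eq_zero_of_ne_one hχ, ← Finset.mul_sum,
    hdouble]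
  field_simp
  ring

open ZMod in
theorem DirichletCharacter.norm_gaussSum_sq {N : ℕ} [NeZero N] {χ : DirichletCharacter ℂ N}
    (hprim : χ.IsPrimitive) : ‖gaussSum χ stdAddChar‖ ^ 2 = N := by
  have h : gaussSum χ stdAddChar * star (gaussSum χ stdAddChar) = N := by
    have hdft := congrFun (dft_dft (χ : ZMod N → ℂ)) (-1)
    simp only [dft_apply (dft _), hprim.fourierTransform_eq_inv_mul_gaussSum, neg_neg, mul_neg,
      mul_one, map_one, smul_eq_mul] at hdft
    rw [← hdft, star_gaussSum_eq]
    change _ * ∑ k, χ⁻¹ k * (stdAddChar (N := N))⁻¹ k = _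
    rw [Finset.mul_sum]
    refine Fintype.sum_equiv (Equiv.neg _) _ _ fun k ↦ ?_
    simp only [Equiv.neg_apply, neg_neg, AddChar.inv_apply]
    ring
  have hnorm := congrArg norm h
  rwa [norm_mul, norm_star, Complex.norm_natCast, ← sq] at hnorm

open ZMod in
theorem DirichletCharacter.norm_LFunction_apply_one_sq {N : ℕ} [NeZero N]
    {χ : DirichletCharacter ℂ N} (hodd : χ.Odd) (hprim : χ.IsPrimitive) :
    ‖DirichletCharacter.LFunction χ 1‖ ^ 2
      = Real.pi ^ 2 / N ^ 3 * ‖∑ r : ZMod N, (r.val : ℂ) * χ⁻¹ r‖ ^ 2 := by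
  have hN : (N : ℝ) ≠ 0 := NeZero.ne _
  rw [DirichletCharacter.LFunction_apply_one_of_odd hodd hprim]
  simp only [norm_mul, norm_div, norm_pow, Complex.norm_natCast, Complex.norm_I, Complex.norm_real,
    mul_pow, div_pow, DirichletCharacter.norm_gaussSum_sq hprim, Real.norm_eq_abs, sq_abs]
  field_simp

theorem norm_sq_eq_norm_pow_four_of_cyclotomic_twenty {z : ℂ}
    (hz : z ^ 8 - z ^ 6 + z ^ 4 - z ^ 2 + 1 = 0) (hnorm : ‖z‖ = 1) :
    125 * ‖2 * z ^ 2 + 2 * z ^ 3 - z ^ 5 + z ^ 7‖ ^ 2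
      = ‖1 + 2 * z + 3 * z ^ 2 + z ^ 3 - 2 * z ^ 4 + z ^ 5 + z ^ 6 + 2 * z ^ 7‖ ^ 4 := by
  have hpow : z ^ 10 = -1 := by linear_combination (z ^ 2 + 1) * hz
  have hmul : z * starRingEnd ℂ z = 1 := by rw [Complex.mul_conj', hnorm]; norm_num
  have hconj (j k : ℕ) (hjk : j + k = 10) : starRingEnd ℂ z ^ k = -z ^ j := by
    have hk : z ^ k * starRingEnd ℂ z ^ k = 1 := by rw [← mul_pow, hmul, one_pow]
    rw [← hjk, pow_add] at hpow
    linear_combination starRingEnd ℂ z ^ k * hpow - z ^ j * hk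
  set p : ℂ := 2 * z ^ 2 + 2 * z ^ 3 - z ^ 5 + z ^ 7 with hp_def
  set b : ℂ := 1 + 2 * z + 3 * z ^ 2 + z ^ 3 - 2 * z ^ 4 + z ^ 5 + z ^ 6 + 2 * z ^ 7 with hb_def
  have hp : (‖p‖ : ℂ) ^ 2
      = 7 + 8 * z - 6 * z ^ 3 - z ^ 4 + 4 * z ^ 5 + z ^ 6 - 2 * z ^ 7 := by
    have hstar : starRingEnd ℂ p = -z ^ 3 + z ^ 5 - 2 * z ^ 7 - 2 * z ^ 8 := by
      simp only [hp_def, map_add, map_sub, map_mul, map_pow, map_ofNat]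
      rw [hconj 8 2 rfl, hconj 7 3 rfl, hconj 5 5 rfl, hconj 3 7 rfl]
      ring
    rw [← Complex.mul_conj', hstar, hp_def]
    linear_combination (-7 - 8 * z - 7 * z ^ 2 - 2 * z ^ 3 + z ^ 4 - 2 * z ^ 6 - 2 * z ^ 7) * hz
  have hb : (‖b‖ : ℂ) ^ 2 = 25 + 20 * z - 15 * z ^ 3 + 10 * z ^ 5 - 5 * z ^ 7 := by
    have hstar : starRingEnd ℂ b
        = 1 - 2 * z ^ 3 - z ^ 4 - z ^ 5 + 2 * z ^ 6 - z ^ 7 - 3 * z ^ 8 - 2 * z ^ 9 := by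
      have h1 : starRingEnd ℂ z = -z ^ 9 := by rw [← hconj 9 1 rfl, pow_one]
      simp only [hb_def, map_add, map_sub, map_mul, map_pow, map_ofNat, map_one]
      rw [hconj 8 2 rfl, hconj 7 3 rfl, hconj 6 4 rfl, hconj 5 5 rfl, hconj 4 6 rfl,
        hconj 3 7 rfl, h1]
      ring
    rw [← Complex.mul_conj', hstar, hb_def]
    linear_combination (-24 - 18 * z - 21 * z ^ 2 - 4 * z ^ 3 - 4 * z ^ 4 - 4 * z ^ 5
        - 11 * z ^ 6 - 8 * z ^ 7 - 4 * z ^ 8) * hz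
  have h : (125 * ‖p‖ ^ 2 : ℂ) = (‖b‖ : ℂ) ^ 4 := by
    rw [show 4 = 2 * 2 from rfl, pow_mul, hp, hb]
    linear_combination (250 - 150 * z ^ 2 + 75 * z ^ 4 - 25 * z ^ 6) * hz
  exact_mod_cast h

theorem DirichletCharacter.apply_two_pow_eq_neg_one {χ : DirichletCharacter ℂ (5 ^ 2)}
    (hodd : χ.Odd) : χ 2 ^ 10 = -1 := by
  rw [← map_pow, show (2 : ZMod (5 ^ 2)) ^ 10 = -1 by decide]
  exact hodd

theorem DirichletCharacter.apply_two_pow_four_ne_one {χ : DirichletCharacter ℂ (5 ^ 2)}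
    (hprim : χ.IsPrimitive) : χ 2 ^ 4 ≠ 1 := by
  intro h
  have hdvd : 5 ∣ 5 ^ 2 := by norm_num
  have hfac : χ.FactorsThrough 5 := by
    rw [factorsThrough_iff_ker_unitsMap hdvd]
    intro u hu
    have hpow : ∀ v : (ZMod (5 ^ 2))ˣ, ZMod.unitsMap (show 5 ∣ 5 ^ 2 by norm_num) v = 1 →
        ∃ k < 5, (v : ZMod (5 ^ 2)) = (2 ^ 4) ^ k := by decide
    obtain ⟨k, -, hk⟩ := hpow u hu
    rw [MonoidHom.mem_ker, Units.ext_iff, MulChar.coe_toUnitHom, hk, map_pow, map_pow, h, one_pow,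
      Units.val_one]
  have hle : χ.conductor ≤ 5 := Nat.sInf_le hfac
  rw [show χ.conductor = 5 ^ 2 from hprim] at hle
  norm_num at hle

theorem DirichletCharacter.sum_range_mul_conj (χ : DirichletCharacter ℂ (5 ^ 2)) (f : ℕ → ℂ) :
    ∑ a ∈ Finset.range (5 ^ 2), f a * starRingEnd ℂ (χ (a : ZMod (5 ^ 2)))
      = ∑ k ∈ Finset.range 20, f (2 ^ k % 25) * starRingEnd ℂ (χ 2) ^ k := by
  have hval (k : ℕ) : starRingEnd ℂ (χ 2) ^ k
      = starRingEnd ℂ (χ ((2 ^ k % 25 : ℕ) : ZMod (5 ^ 2))) := by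
    have : ((2 ^ k % 25 : ℕ) : ZMod (5 ^ 2)) = 2 ^ k := by
      rw [show 25 = 5 ^ 2 by rfl, ZMod.natCast_mod]
      push_cast
      rfl
    rw [this, map_pow, map_pow]
  simp only [hval]
  rw [← Finset.sum_image (g := fun k ↦ 2 ^ k % 25)
    (f := fun a ↦ f a * starRingEnd ℂ (χ (a : ZMod (5 ^ 2)))) (by decide)]
  refine (Finset.sum_subset (by decide) fun a ha ha' ↦ ?_).symm
  have hcop : ∀ a ∈ Finset.range (5 ^ 2),
      a ∉ (Finset.range 20).image (fun k ↦ 2 ^ k % 25) → ¬ a.Coprime (5 ^ 2) := by decide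
  rw [χ.map_nonunit (fun h ↦ hcop a ha ha' ((ZMod.isUnit_iff_coprime a _).1 h)), map_zero, mul_zero]

namespace Collision

/-- The integer `b · S°(a)`. -/
def scaledScirc (b a : ℕ) : ℤ :=
  b * S b a - ∑ a' ∈ cosetUnits b a, S b a'

theorem Scirc_eq_scaledScirc_div {b : ℕ} (hb : b ≠ 0) (a : ℕ) :
    Scirc b a = scaledScirc b a / b := by
  have : (b : ℝ) ≠ 0 := Nat.cast_ne_zero.2 hb
  rw [Scirc, scaledScirc]
  push_cast
  field_simp

theorem scaledScirc_five_two_pow :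
    (List.range 20).map (fun k ↦ scaledScirc 5 (2 ^ k % 25))
      = [4, 8, 16, 12, 4, -2, -4, 2, 4, 8, -4, -8, -16, -12, -4, 2, 4, -2, -4, -8] := by
  decide

variable {χ : DirichletCharacter ℂ (5 ^ 2)}

theorem Shat_five_eq (hz : starRingEnd ℂ (χ 2) ^ 8 - starRingEnd ℂ (χ 2) ^ 6
      + starRingEnd ℂ (χ 2) ^ 4 - starRingEnd ℂ (χ 2) ^ 2 + 1 = 0) :
    Shat 5 χ = 1 / 5 * (2 * starRingEnd ℂ (χ 2) ^ 2 + 2 * starRingEnd ℂ (χ 2) ^ 3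
      - starRingEnd ℂ (χ 2) ^ 5 + starRingEnd ℂ (χ 2) ^ 7) := by
  have hvals := scaledScirc_five_two_pow
  simp only [List.range_succ, List.range_zero, List.map_cons, List.map_nil,
    List.nil_append, List.cons_append, List.cons.injEq, and_true] at hvals
  rw [Shat, DirichletCharacter.sum_range_mul_conj, show Nat.totient (5 ^ 2) = 20 by decide]
  simp only [Scirc_eq_scaledScirc_div (show (5 : ℕ) ≠ 0 by norm_num)]
  simp only [Finset.sum_range_succ, Finset.sum_range_zero, hvals]
  generalize starRingEnd ℂ (χ 2) = z at hz
  push_cast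
  linear_combination (1 / 100 : ℂ) * (
    (-4 - 8 * z - 16 * z ^ 2 - 12 * z ^ 3 - 4 * z ^ 4 + 2 * z ^ 5 + 4 * z ^ 6 - 2 * z ^ 7
      - 4 * z ^ 8 - 8 * z ^ 9) * (z ^ 2 + 1)
    + 8 + 16 * z) * hz

theorem sum_natCast_mul_conj_eq (hz : starRingEnd ℂ (χ 2) ^ 8 - starRingEnd ℂ (χ 2) ^ 6
      + starRingEnd ℂ (χ 2) ^ 4 - starRingEnd ℂ (χ 2) ^ 2 + 1 = 0) :
    ∑ a ∈ Finset.range (5 ^ 2), (a : ℂ) * starRingEnd ℂ (χ (a : ZMod (5 ^ 2)))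
      = -10 * (1 + 2 * starRingEnd ℂ (χ 2) + 3 * starRingEnd ℂ (χ 2) ^ 2
        + starRingEnd ℂ (χ 2) ^ 3 - 2 * starRingEnd ℂ (χ 2) ^ 4 + starRingEnd ℂ (χ 2) ^ 5
        + starRingEnd ℂ (χ 2) ^ 6 + 2 * starRingEnd ℂ (χ 2) ^ 7) := by
  rw [DirichletCharacter.sum_range_mul_conj]
  simp only [Finset.sum_range_succ, Finset.sum_range_zero]
  generalize starRingEnd ℂ (χ 2) = z at hz
  norm_num
  linear_combination (
    (24 + 23 * z + 21 * z ^ 2 + 17 * z ^ 3 + 9 * z ^ 4 + 18 * z ^ 5 + 11 * z ^ 6 + 22 * z ^ 7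
      + 19 * z ^ 8 + 13 * z ^ 9) * (z ^ 2 + 1)
    - 13 - z) * hz

end Collision

open Collision in
theorem stmt17 (χ : DirichletCharacter ℂ (5 ^ 2)) (hprim : χ.IsPrimitive) (hodd : χ.Odd) :
    ‖Shat 5 χ‖
      = (5 * Real.sqrt 5 / (4 * Real.pi ^ 2)) *
          ‖DirichletCharacter.LFunction χ 1‖ ^ 2 := by
  have hpow := DirichletCharacter.apply_two_pow_eq_neg_one hodd
  have hχ : χ 2 ^ 8 - χ 2 ^ 6 + χ 2 ^ 4 - χ 2 ^ 2 + 1 = 0 := by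
    have hne : χ 2 ^ 2 + 1 ≠ 0 := fun h ↦
      DirichletCharacter.apply_two_pow_four_ne_one hprim (by linear_combination (χ 2 ^ 2 - 1) * h)
    refine (mul_eq_zero.1 ?_).resolve_left hne
    linear_combination hpow
  have hz := congrArg (starRingEnd ℂ) hχ
  simp only [map_add, map_sub, map_pow, map_one, map_zero] at hz
  have hnorm : ‖starRingEnd ℂ (χ 2)‖ = 1 := by
    rw [RCLike.norm_conj]
    exact (pow_eq_one_iff_of_nonneg (norm_nonneg _) (by norm_num : 10 ≠ 0)).1
      (by rw [← norm_pow, hpow, norm_neg, norm_one])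
  have hsum : ∑ r : ZMod (5 ^ 2), (r.val : ℂ) * χ⁻¹ r
      = ∑ a ∈ Finset.range (5 ^ 2), (a : ℂ) * starRingEnd ℂ (χ (a : ZMod (5 ^ 2))) := by
    rw [← ZMod.sum_val_eq_sum_range
      fun a ↦ (a : ℂ) * starRingEnd ℂ (χ (a : ZMod (5 ^ 2)))]
    exact Finset.sum_congr rfl fun r _ ↦ by
      rw [ZMod.natCast_zmod_val, starRingEnd_apply, MulChar.star_apply']
  rw [DirichletCharacter.norm_LFunction_apply_one_sq hodd hprim, hsum, sum_natCast_mul_conj_eq hz,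
    Shat_five_eq hz, norm_mul, norm_mul]
  have key := norm_sq_eq_norm_pow_four_of_cyclotomic_twenty hz hnorm
  set p := ‖2 * starRingEnd ℂ (χ 2) ^ 2 + 2 * starRingEnd ℂ (χ 2) ^ 3
    - starRingEnd ℂ (χ 2) ^ 5 + starRingEnd ℂ (χ 2) ^ 7‖
  set b := ‖1 + 2 * starRingEnd ℂ (χ 2) + 3 * starRingEnd ℂ (χ 2) ^ 2
    + starRingEnd ℂ (χ 2) ^ 3 - 2 * starRingEnd ℂ (χ 2) ^ 4 + starRingEnd ℂ (χ 2) ^ 5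
    + starRingEnd ℂ (χ 2) ^ 6 + 2 * starRingEnd ℂ (χ 2) ^ 7‖
  have hsq : √5 ^ 2 = 5 := Real.sq_sqrt (by norm_num)
  have hp : p = √5 * b ^ 2 / 25 := by
    rw [← sq_eq_sq₀ (norm_nonneg _) (by positivity)]
    linear_combination (1 / 125) * key - b ^ 4 / 625 * hsq
  have hπ := Real.pi_ne_zero
  have h15 : ‖(1 / 5 : ℂ)‖ = 1 / 5 := by norm_num
  have h10 : ‖(-10 : ℂ)‖ = 10 := by norm_num
  rw [h15, h10, hp]
  push_cast
  field_simp
  ring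
end

section
/- The fourth moment of L-values at s = 1 over the primitive odd Dirichlet characters modulo 25 is computed exactly by the centered collision invariant: Σ_χ |L(1,χ)|⁴ = (4π⁴/625)·Σ_a |S°(a)|², where the left sum runs over the 8 primitive odd Dirichlet characters χ modulo 25 and the right sum runs over all a ∈ {0,…,24} with gcd(a,25) = 1. -/
open Finset
open scoped Classical

section CollisionMoment

open Complex HurwitzZeta Filter Topology

lemma rpow_neg_sub_rpow_neg_le_s18 {c x y s : ℝ} (hc : 0 < c) (hc1 : c ≤ 1) (hcx : c ≤ x)
    (hxy : x ≤ y) (hyx : y ≤ x + 1) (hs1 : 1 ≤ s) (hs2 : s ≤ 2) :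
    x ^ (-s) - y ^ (-s) ≤ 2 / c / x ^ 2 := by
  have hx : 0 < x := hc.trans_le hcx
  have hy : 0 < y := hx.trans_le hxy
  have hbase : x ^ (-s) ≤ 1 / c / x := by
    have h1 : x ^ (-s) = x⁻¹ * (x ^ (s - 1))⁻¹ := by
      rw [← Real.rpow_neg hx.le, ← Real.rpow_neg_one x, ← Real.rpow_add hx]; ring_nf
    have h2 : c ≤ x ^ (s - 1) := calc
      c = c ^ (1 : ℝ) := (Real.rpow_one c).symm
      _ ≤ c ^ (s - 1) := Real.rpow_le_rpow_of_exponent_ge hc hc1 (by linarith)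
      _ ≤ x ^ (s - 1) := Real.rpow_le_rpow hc.le hcx (by linarith)
    calc x ^ (-s) = x⁻¹ * (x ^ (s - 1))⁻¹ := h1
      _ ≤ x⁻¹ * c⁻¹ := by gcongr
      _ = 1 / c / x := by field_simp
  have hratio : 1 - (x / y) ^ s ≤ 2 / x := by
    have h1 : (x / y) ^ (2 : ℝ) ≤ (x / y) ^ s :=
      Real.rpow_le_rpow_of_exponent_ge (by positivity) ((div_le_one hy).2 hxy) hs2
    have h2 : 1 - (x / y) ^ 2 ≤ 2 / x := by
      rw [div_pow, one_sub_div (by positivity), div_le_div_iff₀ (by positivity) hx]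
      nlinarith [mul_nonneg (sub_nonneg.2 hxy) hx.le, mul_nonneg (sub_nonneg.2 hxy) hy.le,
        mul_nonneg (sub_nonneg.2 hyx) hx.le, mul_nonneg (mul_nonneg (sub_nonneg.2 hyx) hx.le) hx.le,
        mul_nonneg (mul_nonneg (sub_nonneg.2 hyx) hx.le) hy.le,
        mul_nonneg (mul_nonneg (sub_nonneg.2 hxy) hy.le) hy.le]
    rw [Real.rpow_two] at h1
    linarith
  have hfac : x ^ (-s) - y ^ (-s) = x ^ (-s) * (1 - (x / y) ^ s) := by
    rw [Real.div_rpow hx.le hy.le, Real.rpow_neg hx.le, Real.rpow_neg hy.le]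
    field_simp
  calc x ^ (-s) - y ^ (-s) = x ^ (-s) * (1 - (x / y) ^ s) := hfac
    _ ≤ 1 / c / x * (2 / x) := by
      refine mul_le_mul hbase hratio (sub_nonneg.2 ?_) (by positivity)
      exact Real.rpow_le_one (by positivity) ((div_le_one hy).2 hxy) (by linarith)
    _ = 2 / c / x ^ 2 := by field_simp

lemma abs_rpow_neg_sub_rpow_neg_le_s18 {c t x y s : ℝ} (hc : 0 < c) (hc1 : c ≤ 1) (hct : c ≤ t)
    (hx : x ∈ Set.Icc t (t + 1)) (hy : y ∈ Set.Icc t (t + 1)) (hs : s ∈ Set.Icc 1 2) :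
    |x ^ (-s) - y ^ (-s)| ≤ 2 / c / t ^ 2 := by
  have ht : 0 < t := hc.trans_le hct
  wlog hxy : x ≤ y generalizing x y
  · rw [abs_sub_comm]
    exact this hy hx (le_of_not_ge hxy)
  have hx0 : 0 < x := ht.trans_le hx.1
  rw [abs_of_nonneg (sub_nonneg.2 (Real.rpow_le_rpow_of_nonpos hx0 hxy (by linarith [hs.1])))]
  refine (rpow_neg_sub_rpow_neg_le_s18 hc hc1 (hct.trans hx.1) hxy (by linarith [hx.1, hy.2])
    hs.1 hs.2).trans ?_
  have := hx.1
  gcongr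

lemma hasSum_half_cot {a : ℝ} (ha : a ∈ Set.Ioo 0 1)
    (hsum : Summable fun n : ℕ ↦ (1 / (n + a : ℂ) - 1 / (n + 1 - a : ℂ)) / 2) :
    HasSum (fun n : ℕ ↦ (1 / (n + a : ℂ) - 1 / (n + 1 - a : ℂ)) / 2)
      (Real.pi / 2 * cot (Real.pi * a)) := by
  have hmem : (a : ℂ) ∈ integerComplement := by
    rw [mem_integerComplement_iff]
    rintro ⟨n, hn⟩
    have hn' : (n : ℝ) = a := by exact_mod_cast hn
    have h0 := ha.1
    have h1 := ha.2
    rw [← hn'] at h0 h1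
    have h0' : 0 < n := by exact_mod_cast h0
    have h1' : n < 1 := by exact_mod_cast h1
    omega
  refine (hsum.hasSum_iff_tendsto_nat).2 ?_
  rw [← tendsto_add_atTop_iff_nat 1]
  have hpartial : ∀ M : ℕ, ∑ n ∈ range (M + 1), (1 / (n + a : ℂ) - 1 / (n + 1 - a : ℂ)) / 2
      = (1 / a + ∑ n ∈ range M, cotTerm a n - 1 / ((M : ℂ) + (1 - a))) / 2 := by
    intro M
    induction M with
    | zero => simp
    | succ M ih =>
      rw [sum_range_succ, ih, sum_range_succ _ M, cotTerm]
      have h : (a : ℂ) - (M + 1) = -(M + (1 - a)) := by ring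
      rw [h, one_div_neg_eq_neg_one_div]
      push_cast
      ring_nf
  simp_rw [hpartial]
  have h1 : Tendsto (fun M : ℕ ↦ 1 / ((M : ℂ) + (1 - a))) atTop (𝓝 0) := by
    simp_rw [one_div]
    refine tendsto_inv₀_cobounded.comp ?_
    exact (tendsto_add_const_cobounded _).comp tendsto_natCast_atTop_cobounded
  have := (((tendsto_logDeriv_euler_cot_sub hmem).const_add (1 / (a : ℂ))).sub h1).div_const 2
  convert this using 2
  ring

lemma hurwitzZetaOdd_one {a : ℝ} (ha : a ∈ Set.Ioo 0 1) :
    hurwitzZetaOdd a 1 = Real.pi / 2 * cot (Real.pi * a) := by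
  set F : ℝ → ℕ → ℂ := fun s n ↦ (1 / (n + a : ℂ) ^ (s : ℂ) - 1 / (n + 1 - a : ℂ) ^ (s : ℂ)) / 2
    with hF
  set c := min a (1 - a) with hc
  have hc0 : 0 < c := lt_min ha.1 (by linarith [ha.2])
  have hca : c ≤ a := min_le_left _ _
  have hca' : c ≤ 1 - a := min_le_right _ _
  have hc1 : c ≤ 1 := hca.trans ha.2.le
  have hFreal : ∀ (s : ℝ) (n : ℕ), F s n
      = (((n + a : ℝ) ^ (-s) - (n + 1 - a : ℝ) ^ (-s)) / 2 : ℝ) := by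
    intro s n
    have h1 : (0 : ℝ) ≤ n + a := by linarith [ha.1, (n.cast_nonneg : (0 : ℝ) ≤ n)]
    have h2 : (0 : ℝ) ≤ n + 1 - a := by linarith [ha.2, (n.cast_nonneg : (0 : ℝ) ≤ n)]
    rw [Real.rpow_neg h1, Real.rpow_neg h2]
    push_cast [ofReal_cpow h1, ofReal_cpow h2]
    simp [hF]
  have hbound : ∀ s ∈ Set.Icc (1 : ℝ) 2, ∀ n : ℕ, ‖F s n‖ ≤ 1 / c * (1 / |n + c| ^ (2 : ℝ)) := by
    intro s hs n
    have hn : (0 : ℝ) ≤ n := n.cast_nonneg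
    rw [hFreal, norm_real, Real.norm_eq_abs, abs_div, abs_two, abs_of_pos (by linarith : 0 < n + c),
      Real.rpow_two]
    have := abs_rpow_neg_sub_rpow_neg_le_s18 (t := n + c) (x := n + a) (y := n + 1 - a) hc0 hc1
      (by linarith) ⟨by linarith, by linarith⟩ ⟨by linarith, by linarith⟩ hs
    calc _ ≤ 2 / c / (n + c) ^ 2 / 2 := by gcongr
      _ = _ := by field_simp
  have hsummable : Summable fun n : ℕ ↦ 1 / c * (1 / |n + c| ^ (2 : ℝ)) :=
    ((Real.summable_one_div_nat_add_rpow c 2).2 (by norm_num)).mul_left _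
  have hcont : ∀ n : ℕ, Tendsto (fun s : ℝ ↦ F s n) (𝓝[>] 1) (𝓝 (F 1 n)) := by
    intro n
    have h1 : (0 : ℝ) < n + a := by linarith [ha.1, (n.cast_nonneg : (0 : ℝ) ≤ n)]
    have h2 : (0 : ℝ) < n + 1 - a := by linarith [ha.2, (n.cast_nonneg : (0 : ℝ) ≤ n)]
    have h : Continuous fun s : ℝ ↦ F s n := by
      simp_rw [hFreal]
      refine continuous_ofReal.comp (Continuous.div_const (Continuous.sub ?_ ?_) 2)
      · exact continuous_const.rpow continuous_neg fun _ ↦ Or.inl h1.ne'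
      · exact continuous_const.rpow continuous_neg fun _ ↦ Or.inl h2.ne'
    exact h.continuousWithinAt
  have hlim := tendsto_tsum_of_dominated_convergence (f := F) hsummable hcont
    (by filter_upwards [Ioc_mem_nhdsGT (one_lt_two (α := ℝ))] with s hs using
      hbound s ⟨hs.1.le, hs.2⟩)
  have hlim' : Tendsto (fun s : ℝ ↦ ∑' n, F s n) (𝓝[>] 1) (𝓝 (hurwitzZetaOdd a 1)) := by
    have h : Tendsto (fun s : ℝ ↦ hurwitzZetaOdd a s) (𝓝[>] 1) (𝓝 (hurwitzZetaOdd a (1 : ℝ))) :=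
      ((differentiable_hurwitzZetaOdd a).continuous.comp continuous_ofReal).continuousWithinAt
    rw [ofReal_one] at h
    refine h.congr' ?_
    filter_upwards [self_mem_nhdsWithin] with s hs
    exact (hasSum_nat_hurwitzZetaOdd_of_mem_Icc ⟨ha.1.le, ha.2.le⟩
      (by simpa using hs)).tsum_eq.symm
  have hF1 : F 1 = fun n : ℕ ↦ (1 / (n + a : ℂ) - 1 / (n + 1 - a : ℂ)) / 2 := by
    ext n; simp [hF]
  have hsumF : Summable (F 1) :=
    .of_norm_bounded hsummable (hbound 1 ⟨le_rfl, one_le_two⟩)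
  rw [tendsto_nhds_unique hlim' hlim, hF1]
  exact (hasSum_half_cot ha (hF1 ▸ hsumF)).tsum_eq

lemma sum_natCast_mul_pow {N : ℕ} {z : ℂ} (hz : z ^ N = 1) (hz1 : z ≠ 1) :
    ∑ k ∈ range N, (k : ℂ) * z ^ k = N / (z - 1) := by
  have h : ∀ M : ℕ, (z - 1) * ((z - 1) * ∑ k ∈ range M, (k : ℂ) * z ^ k)
      = M * z ^ M * (z - 1) - z * (z ^ M - 1) := by
    intro M
    induction M with
    | zero => simp
    | succ M ih =>
      rw [sum_range_succ, mul_add, mul_add, ih]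
      push_cast
      ring
  have hz' := sub_ne_zero.2 hz1
  rw [eq_div_iff hz', mul_comm]
  apply mul_left_cancel₀ hz'
  rw [h N, hz]
  ring

variable {N : ℕ} [NeZero N]

lemma hurwitzZetaOdd_toAddCircle_one {j : ZMod N} (hj : j ≠ 0) :
    I * hurwitzZetaOdd (ZMod.toAddCircle j) 1
      = -(Real.pi / 2) * (1 + 2 / N * ∑ k : ZMod N, (k.val : ℂ) * ZMod.stdAddChar (j * k)) := by
  have hN : (0 : ℝ) < N := by exact_mod_cast NeZero.pos N
  have hj0 : (0 : ℝ) < j.val := by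
    exact_mod_cast Nat.pos_of_ne_zero ((ZMod.val_ne_zero j).2 hj)
  have hjN : (j.val : ℝ) < N := by exact_mod_cast ZMod.val_lt j
  have hval : ZMod.toAddCircle j = ((j.val / N : ℝ) : UnitAddCircle) := by
    conv_lhs => rw [← ZMod.natCast_zmod_val j, ZMod.toAddCircle_natCast]
  set z : ℂ := ZMod.stdAddChar j with hz
  have hz_exp : z = exp (2 * I * (Real.pi * (j.val / N : ℝ))) := by
    rw [hz, ZMod.stdAddChar_apply, ZMod.toCircle_apply]
    push_cast
    ring_nf
  have hz1 : z ≠ 1 := by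
    rw [hz, ← (ZMod.stdAddChar (N := N)).map_zero_eq_one]
    exact fun h ↦ hj (ZMod.injective_stdAddChar h)
  have hpow : ∀ k : ℕ, ZMod.stdAddChar (j * (k : ZMod N)) = z ^ k := by
    intro k
    rw [hz, ← AddChar.map_nsmul_eq_pow, nsmul_eq_mul, mul_comm]
  have hsum : ∑ k : ZMod N, (k.val : ℂ) * ZMod.stdAddChar (j * k) = N / (z - 1) := by
    rw [← sum_natCast_mul_pow (by rw [← hpow]; simp) hz1]
    refine sum_nbij' ZMod.val (fun k ↦ (k : ZMod N)) ?_ ?_ ?_ ?_ ?_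
    · simp [ZMod.val_lt]
    · simp
    · simp
    · intro k hk
      exact ZMod.val_cast_of_lt (mem_range.1 hk)
    · intro k _
      rw [← hpow, ZMod.natCast_zmod_val]
  rw [hval, hurwitzZetaOdd_one ⟨by positivity, (div_lt_one hN).2 hjN⟩, hsum, cot_eq_exp_ratio,
    ← hz_exp]
  have hz' := sub_ne_zero.2 hz1
  have hz'' := sub_ne_zero.2 hz1.symm
  have hN' : (N : ℂ) ≠ 0 := NeZero.ne _
  have hI : (1 - z)⁻¹ = - (z - 1)⁻¹ := by rw [← inv_neg, neg_sub]
  rw [div_eq_mul_inv _ (I * (1 - z)), mul_inv, hI]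
  field_simp
  ring

lemma DirichletCharacter.IsPrimitive.gaussSum_mul_conj {χ : DirichletCharacter ℂ N}
    (hχ : χ.IsPrimitive) :
    gaussSum χ ZMod.stdAddChar * starRingEnd ℂ (gaussSum χ ZMod.stdAddChar) = N := by
  have h := congr_fun (ZMod.dft_dft χ) (-1)
  rw [ZMod.dft_apply] at h
  simp_rw [hχ.fourierTransform_eq_inv_mul_gaussSum] at h
  simp only [neg_neg, map_one, smul_eq_mul, mul_one] at h
  rw [← h, gaussSum, map_sum, mul_comm, ← gaussSum, sum_mul]
  refine Fintype.sum_equiv (Equiv.neg _) _ _ fun k ↦ ?_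
  have hinv : χ⁻¹ k = starRingEnd ℂ (χ k) := (MulChar.star_apply' χ k).symm
  simp [← AddChar.map_neg_eq_conj, hinv, mul_comm, mul_left_comm]

lemma DirichletCharacter.norm_LFunction_one {χ : DirichletCharacter ℂ N}
    (hχ : χ.IsPrimitive) (hodd : χ.Odd) :
    ‖χ.LFunction 1‖ = Real.pi / N ^ 2 * √N * ‖∑ k : ZMod N, (k.val : ℂ) * χ k‖ := by
  have hN : (0 : ℝ) < N := by exact_mod_cast NeZero.pos N
  have hN' : (N : ℂ) ≠ 0 := NeZero.ne _
  set τ := gaussSum χ ZMod.stdAddChar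
  have hneg : ∀ k, χ (-k) = -χ k := hodd.to_fun
  have hχ0 : χ 0 = 0 := by
    have := hneg 0
    rwa [neg_zero, self_eq_neg] at this
  have hsum0 : ∑ k, χ k = 0 := by
    rw [← self_eq_neg, ← sum_neg_distrib]
    exact Fintype.sum_equiv (Equiv.neg _) _ _ fun k ↦ by simp [hneg]
  have hτ : ‖τ‖ = √N := by
    rw [eq_comm, Real.sqrt_eq_iff_mul_self_eq hN.le (norm_nonneg _), ← sq, ← ofReal_inj]
    push_cast
    rw [← mul_conj', hχ.gaussSum_mul_conj]
  have hdft : ∀ k, ∑ j, χ j * ZMod.stdAddChar (j * k) = starRingEnd ℂ (χ k) * τ := by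
    intro k
    have h := hχ.fourierTransform_eq_inv_mul_gaussSum (-k)
    rw [ZMod.dft_apply] at h
    rw [neg_neg, ← MulChar.star_apply'] at h
    rw [starRingEnd_apply, ← h]
    simp [mul_comm]
  have hL : I * (N * χ.LFunction 1)
      = -(Real.pi / N) * τ * starRingEnd ℂ (∑ k : ZMod N, (k.val : ℂ) * χ k) := by
    have hterm : ∀ j, I * (χ j * hurwitzZetaOdd (ZMod.toAddCircle j) 1) =
        χ j * (-(Real.pi / 2) *
          (1 + 2 / N * ∑ k : ZMod N, (k.val : ℂ) * ZMod.stdAddChar (j * k))) := by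
      intro j
      rcases eq_or_ne j 0 with rfl | hj
      · simp [hχ0]
      · rw [← hurwitzZetaOdd_toAddCircle_one hj]
        ring
    have hdouble : ∑ j, χ j * ∑ k : ZMod N, (k.val : ℂ) * ZMod.stdAddChar (j * k)
        = τ * starRingEnd ℂ (∑ k : ZMod N, (k.val : ℂ) * χ k) := by
      simp_rw [mul_sum, map_sum, mul_sum]
      rw [sum_comm]
      refine sum_congr rfl fun k _ ↦ ?_
      rw [map_mul, conj_natCast, mul_left_comm, mul_comm τ, ← hdft k, mul_sum]
      exact sum_congr rfl fun j _ ↦ by ring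
    rw [LFunction, ZMod.LFunction_def_odd hodd.to_fun, cpow_neg_one, mul_inv_cancel_left₀ hN',
      mul_sum, sum_congr rfl fun j _ ↦ hterm j]
    calc _ = -(Real.pi / 2) * (∑ k, χ k) + -(Real.pi / N) *
          ∑ j, χ j * ∑ k : ZMod N, (k.val : ℂ) * ZMod.stdAddChar (j * k) := by
          rw [mul_sum, mul_sum, ← sum_add_distrib]
          exact sum_congr rfl fun j _ ↦ by ring
      _ = _ := by rw [hsum0, hdouble]; ring
  have hnorm := congr_arg norm hL
  simp only [norm_mul, norm_I, one_mul, Complex.norm_natCast, norm_neg, norm_div, norm_real,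
    Real.norm_of_nonneg Real.pi_pos.le, hτ, RCLike.norm_conj] at hnorm
  rw [← mul_right_inj' hN.ne', hnorm]
  field_simp

section ModulusTwentyFive

variable {χ : DirichletCharacter ℂ (5 ^ 2)}

lemma apply_two_pow_ten (χ : DirichletCharacter ℂ (5 ^ 2)) : χ 2 ^ 10 = χ (-1) := by
  rw [← map_pow]; congr 1

lemma apply_two_pow_twenty (χ : DirichletCharacter ℂ (5 ^ 2)) : χ 2 ^ 20 = 1 := by
  rw [← map_pow, ← map_one χ]; congr 1

lemma factorsThrough_five_iff : χ.FactorsThrough 5 ↔ χ 2 ^ 4 = 1 := by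
  have hd : 5 ∣ 5 ^ 2 := by norm_num
  rw [DirichletCharacter.factorsThrough_iff_ker_unitsMap hd]
  constructor
  · intro h
    let u : (ZMod (5 ^ 2))ˣ := ⟨2 ^ 4, 11, by decide, by decide⟩
    have hu : u ∈ (ZMod.unitsMap hd).ker := by
      rw [MonoidHom.mem_ker, Units.ext_iff, ZMod.unitsMap_val]
      decide
    have hχu := congr_arg Units.val (MonoidHom.mem_ker.1 (h hu))
    rw [MulChar.coe_toUnitHom] at hχu
    rw [← map_pow]
    exact hχu
  · intro h u hu
    rw [MonoidHom.mem_ker, Units.ext_iff, ZMod.unitsMap_val] at hu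
    have hpow : ∀ k : ZMod (5 ^ 2), (k.cast : ZMod 5) = 1 → ∃ i : Fin 5, k = (2 ^ 4) ^ (i : ℕ) := by
      decide
    obtain ⟨i, hi⟩ := hpow u hu
    rw [MonoidHom.mem_ker, Units.ext_iff, MulChar.coe_toUnitHom, hi, map_pow, map_pow, h, one_pow,
      Units.val_one]

lemma isPrimitive_iff_apply_two_pow_four : χ.IsPrimitive ↔ χ 2 ^ 4 ≠ 1 := by
  have hd : 5 ∣ 5 ^ 2 := by norm_num
  rw [ne_eq, ← factorsThrough_five_iff, ← DirichletCharacter.mem_conductorSet_iff,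
    DirichletCharacter.mem_conductorSet_iff_conductor_dvd χ hd, DirichletCharacter.isPrimitive_def]
  constructor
  · intro h
    rw [h]
    norm_num
  · intro h
    obtain ⟨i, hi, hcond⟩ := (Nat.dvd_prime_pow Nat.prime_five).1 χ.conductor_dvd_level
    rw [hcond] at h ⊢
    interval_cases i <;> simp_all

/-- A character modulo `25` is primitive and odd exactly when its value at the primitive root `2`
is a primitive twentieth root of unity. -/
lemma isPrimitive_and_odd_iff : χ.IsPrimitive ∧ χ.Odd ↔
    χ 2 ^ 8 - χ 2 ^ 6 + χ 2 ^ 4 - χ 2 ^ 2 + 1 = 0 := by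
  rw [isPrimitive_iff_apply_two_pow_four, DirichletCharacter.Odd, ← apply_two_pow_ten]
  generalize χ 2 = w
  constructor
  · rintro ⟨h4, h10⟩
    have h : (w ^ 2 + 1) * (w ^ 8 - w ^ 6 + w ^ 4 - w ^ 2 + 1) = 0 := by
      linear_combination h10
    refine (mul_eq_zero.1 h).resolve_left fun h2 ↦ h4 ?_
    linear_combination (w ^ 2 - 1) * h2
  · intro h
    refine ⟨fun h4 ↦ ?_, by linear_combination (w ^ 2 + 1) * h⟩
    have h2 : w ^ 2 = 3 / 2 := by linear_combination h4 * (w ^ 4 - w ^ 2 + 2) / 2 - h / 2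
    have : w ^ 4 = 9 / 4 := by linear_combination (w ^ 2 + 3 / 2) * h2
    rw [h4] at this
    norm_num at this

lemma sum_isPrimitive_odd (f : DirichletCharacter ℂ (5 ^ 2) → ℂ) :
    ∑ χ with χ.IsPrimitive ∧ χ.Odd, f χ = ∑ χ : DirichletCharacter ℂ (5 ^ 2),
      (1 - χ 2 ^ 10) / 2 * (1 - (1 + χ 2 ^ 4 + χ 2 ^ 8 + χ 2 ^ 12 + χ 2 ^ 16) / 5) * f χ := by
  rw [sum_filter]
  refine sum_congr rfl fun χ _ ↦ ?_
  have h20 := apply_two_pow_twenty χ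
  have hiff := isPrimitive_and_odd_iff (χ := χ)
  generalize χ 2 = w at *
  split_ifs with h <;> rw [hiff] at h
  · have h10 : w ^ 10 = -1 := by linear_combination (w ^ 2 + 1) * h
    have h4 : 1 + w ^ 4 + w ^ 8 + w ^ 12 + w ^ 16 = 0 := by
      linear_combination (w ^ 8 + w ^ 6 + w ^ 4 + w ^ 2 + 1) * h
    rw [h10, h4]
    ring
  · have hfac : (1 - w ^ 10) * ((w ^ 2 + 1) * (w ^ 8 - w ^ 6 + w ^ 4 - w ^ 2 + 1)) = 0 := by
      linear_combination -h20
    rcases mul_eq_zero.1 hfac with h10 | h10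
    · rw [h10]
      ring
    · have h2 : w ^ 2 = -1 := eq_neg_of_add_eq_zero_left ((mul_eq_zero.1 h10).resolve_right h)
      have h4 : 1 + w ^ 4 + w ^ 8 + w ^ 12 + w ^ 16 = 5 := by
        simp only [show ∀ n, w ^ (2 * n) = (-1) ^ n from fun n ↦ by rw [pow_mul, h2],
          show w ^ 4 = w ^ (2 * 2) from rfl, show w ^ 8 = w ^ (2 * 4) from rfl,
          show w ^ 12 = w ^ (2 * 6) from rfl, show w ^ 16 = w ^ (2 * 8) from rfl]
        norm_num
      rw [h4]
      ring

lemma sum_apply_two_pow (j : ℕ) :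
    ∑ χ : DirichletCharacter ℂ (5 ^ 2), χ 2 ^ j = if 20 ∣ j then 20 else 0 := by
  simp_rw [← map_pow]
  rw [DirichletCharacter.sum_characters_eq]
  have hord : orderOf (2 : ZMod (5 ^ 2)) = 20 := by
    rw [orderOf_eq_iff (by norm_num)]
    decide
  have htot : Nat.totient (5 ^ 2) = 20 := by decide
  rw [htot]
  simp [← orderOf_dvd_iff_pow_eq_one, hord]

lemma sum_isPrimitive_odd_apply_two_pow (j : ℕ) :
    ∑ χ : DirichletCharacter ℂ (5 ^ 2) with χ.IsPrimitive ∧ χ.Odd, χ 2 ^ j =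
      (if 20 ∣ j then 8 else 0) - (if 20 ∣ j + 4 then 2 else 0) - (if 20 ∣ j + 8 then 2 else 0)
        - (if 20 ∣ j + 12 then 2 else 0) - (if 20 ∣ j + 16 then 2 else 0)
        - (if 20 ∣ j + 10 then 8 else 0) + (if 20 ∣ j + 14 then 2 else 0)
        + (if 20 ∣ j + 18 then 2 else 0) + (if 20 ∣ j + 22 then 2 else 0)
        + (if 20 ∣ j + 26 then 2 else 0) := by
  have hexpand : ∀ w : ℂ,
      (1 - w ^ 10) / 2 * (1 - (1 + w ^ 4 + w ^ 8 + w ^ 12 + w ^ 16) / 5) * w ^ j =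
        2 / 5 * w ^ j - 1 / 10 * w ^ (j + 4) - 1 / 10 * w ^ (j + 8) - 1 / 10 * w ^ (j + 12)
          - 1 / 10 * w ^ (j + 16) - 2 / 5 * w ^ (j + 10) + 1 / 10 * w ^ (j + 14)
          + 1 / 10 * w ^ (j + 18) + 1 / 10 * w ^ (j + 22) + 1 / 10 * w ^ (j + 26) := by
    intro w
    ring
  rw [sum_isPrimitive_odd]
  simp only [hexpand, sum_add_distrib, sum_sub_distrib, ← mul_sum, sum_apply_two_pow, mul_ite,
    mul_zero]
  norm_num

lemma sum_val_mul_apply (χ : DirichletCharacter ℂ (5 ^ 2)) :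
    ∑ k : ZMod (5 ^ 2), (k.val : ℂ) * χ k
      = ∑ j ∈ range 20, ((2 ^ j % 5 ^ 2 : ℕ) : ℂ) * χ 2 ^ j := by
  have hunits : ∀ k : ZMod (5 ^ 2), k ∉ (range 20).image (fun j ↦ (2 : ZMod (5 ^ 2)) ^ j) →
      k * 5 = 0 := by
    decide
  have hinj : Set.InjOn (fun j ↦ (2 : ZMod (5 ^ 2)) ^ j) (range 20) := by
    intro i hi j hj
    have : ∀ i < 20, ∀ j < 20, (2 : ZMod (5 ^ 2)) ^ i = 2 ^ j → i = j := by decide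
    exact this i (mem_range.1 hi) j (mem_range.1 hj)
  rw [← sum_subset (subset_univ ((range 20).image fun j ↦ (2 : ZMod (5 ^ 2)) ^ j)), sum_image hinj]
  · refine sum_congr rfl fun j _ ↦ ?_
    rw [map_pow, ← ZMod.val_natCast]
    push_cast
    rfl
  · intro k _ hk
    rw [χ.map_nonunit fun hu ↦ ?_, mul_zero]
    have h5 : (5 : ZMod (5 ^ 2)) = 0 := (hu.mul_right_eq_zero).1 (hunits k hk)
    exact absurd h5 (by decide)

lemma norm_sum_val_mul_pow_four (h : χ.IsPrimitive ∧ χ.Odd) :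
    ((‖∑ k : ZMod (5 ^ 2), (k.val : ℂ) * χ k‖ ^ 4 : ℝ) : ℂ) =
      8750000 * χ 2 ^ 0 + 10000000 * χ 2 ^ 1 - 7500000 * χ 2 ^ 3 - 1250000 * χ 2 ^ 4
        + 5000000 * χ 2 ^ 5 + 1250000 * χ 2 ^ 6 - 2500000 * χ 2 ^ 7 := by
  have hΦ := isPrimitive_and_odd_iff.1 h
  have h10 : χ 2 ^ 10 = -1 := by rw [apply_two_pow_ten, h.2]
  have hsum := sum_val_mul_apply χ
  generalize ∑ k : ZMod (5 ^ 2), (k.val : ℂ) * χ k = T at *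
  generalize χ 2 = w at *
  replace hsum : T = -10 - 20 * w - 30 * w ^ 2 - 10 * w ^ 3 + 20 * w ^ 4 - 10 * w ^ 5
      - 10 * w ^ 6 - 20 * w ^ 7 := by
    rw [hsum]
    norm_num [sum_range_succ]
    linear_combination (11 + 22 * w + 45 * w ^ 2 + 40 * w ^ 3 + 30 * w ^ 4 + 35 * w ^ 5
      + 20 * w ^ 6 + 40 * w ^ 7 + 30 * w ^ 8 + 35 * w ^ 9 + 19 * w ^ 10 + 13 * w ^ 11) * hΦ
  have hnorm : ‖w‖ = 1 := by
    refine (pow_eq_one_iff_of_nonneg (norm_nonneg w) (by norm_num : 10 ≠ 0)).1 ?_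
    rw [← norm_pow, h10, norm_neg, norm_one]
  have hconj : starRingEnd ℂ w = -w ^ 9 := by
    have hw : w * starRingEnd ℂ w = 1 := by rw [mul_conj', hnorm]; norm_num
    linear_combination starRingEnd ℂ w * h10 - w ^ 9 * hw
  have hconj_pow : ∀ k ≤ 9, starRingEnd ℂ w ^ (k + 1) = -w ^ (9 - k) := by
    intro k hk
    induction k with
    | zero => simpa using hconj
    | succ k ih =>
      have hk' : 9 - k = 9 - (k + 1) + 1 := by omega
      rw [pow_succ, ih (by omega), hconj, hk']
      linear_combination w ^ (9 - (k + 1)) * h10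
  have hTconj : starRingEnd ℂ T = -40 - 20 * w + 30 * w ^ 2 + 40 * w ^ 3 - 20 * w ^ 4
      - 10 * w ^ 5 + 10 * w ^ 6 + 30 * w ^ 7 := by
    simp only [hsum, map_sub, map_add, map_mul, map_neg, map_ofNat, map_pow,
      show starRingEnd ℂ w ^ 2 = -w ^ 8 from hconj_pow 1 (by norm_num),
      show starRingEnd ℂ w ^ 3 = -w ^ 7 from hconj_pow 2 (by norm_num),
      show starRingEnd ℂ w ^ 4 = -w ^ 6 from hconj_pow 3 (by norm_num),
      show starRingEnd ℂ w ^ 5 = -w ^ 5 from hconj_pow 4 (by norm_num),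
      show starRingEnd ℂ w ^ 6 = -w ^ 4 from hconj_pow 5 (by norm_num),
      show starRingEnd ℂ w ^ 7 = -w ^ 3 from hconj_pow 6 (by norm_num)]
    rw [hconj]
    linear_combination (30 + 20 * w) * hΦ
  have hsq : T * starRingEnd ℂ T = 2500 + 2000 * w - 1500 * w ^ 3 + 1000 * w ^ 5 - 500 * w ^ 7 := by
    rw [hTconj, hsum]
    linear_combination (-2100 - 1000 * w - 800 * w ^ 2 + 500 * w ^ 3 - 800 * w ^ 4 - 500 * w ^ 5
      - 600 * w ^ 6) * hΦ
  have hfour : ((‖T‖ ^ 4 : ℝ) : ℂ) = (T * starRingEnd ℂ T) ^ 2 := by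
    rw [mul_conj']
    push_cast
    ring
  rw [hfour, hsq]
  linear_combination (-2500000 + 1500000 * w ^ 2 - 750000 * w ^ 4 + 250000 * w ^ 6) * hΦ

lemma sum_norm_sum_val_mul_pow_four :
    ∑ χ : DirichletCharacter ℂ (5 ^ 2) with χ.IsPrimitive ∧ χ.Odd,
      ‖∑ k : ZMod (5 ^ 2), (k.val : ℂ) * χ k‖ ^ 4 = 75000000 := by
  rw [← ofReal_inj, ofReal_sum,
    sum_congr rfl fun χ hχ ↦ norm_sum_val_mul_pow_four (mem_filter.1 hχ).2]
  simp only [sum_add_distrib, sum_sub_distrib, ← mul_sum, sum_isPrimitive_odd_apply_two_pow]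
  norm_num

end ModulusTwentyFive

open Collision in
lemma sum_Scirc_sq : ∑ a ∈ (range (5 ^ 2)).filter (fun a => Nat.gcd a (5 ^ 2) = 1),
    |Scirc 5 a| ^ 2 = 48 := by
  have hint : ∑ a ∈ (range (5 ^ 2)).filter (fun a => Nat.gcd a (5 ^ 2) = 1),
      (5 * S 5 a - ∑ a' ∈ cosetUnits 5 a, S 5 a') ^ 2 = 1200 := by
    decide +kernel
  have hScirc : ∀ a, |Scirc 5 a| ^ 2
      = ((5 * S 5 a - ∑ a' ∈ cosetUnits 5 a, S 5 a') ^ 2 : ℤ) / 25 := by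
    intro a
    rw [sq_abs, Scirc]
    push_cast
    ring
  simp_rw [hScirc]
  rw [← sum_div, ← Int.cast_sum, hint]
  norm_num

end CollisionMoment

open Collision in
theorem stmt18 :
    ∑ χ ∈ Finset.univ.filter
        (fun χ : DirichletCharacter ℂ (5 ^ 2) => χ.IsPrimitive ∧ χ.Odd),
        ‖DirichletCharacter.LFunction χ 1‖ ^ 4
      = (4 * Real.pi ^ 4 / 625) *
          ∑ a ∈ (Finset.range (5 ^ 2)).filter (fun a => Nat.gcd a (5 ^ 2) = 1),
            |Scirc 5 a| ^ 2 := by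
  have hL : ∀ χ ∈ Finset.univ.filter
      (fun χ : DirichletCharacter ℂ (5 ^ 2) => χ.IsPrimitive ∧ χ.Odd),
      ‖DirichletCharacter.LFunction χ 1‖ ^ 4
        = (Real.pi / 125) ^ 4 * ‖∑ k : ZMod (5 ^ 2), (k.val : ℂ) * χ k‖ ^ 4 := by
    intro χ hχ
    obtain ⟨-, hprim, hodd⟩ := Finset.mem_filter.1 hχ
    rw [DirichletCharacter.norm_LFunction_one hprim hodd, ← mul_pow]
    push_cast
    rw [show √(25 : ℝ) = 5 by rw [show (25 : ℝ) = 5 ^ 2 by norm_num, Real.sqrt_sq (by norm_num)]]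
    ring
  rw [sum_congr rfl hL, ← mul_sum, sum_norm_sum_val_mul_pow_four, sum_Scirc_sq]
  ring
end
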